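/- arXiv:2103.09397 — 5 statements merged into one kernel-verified Lean document; each statement's English description precedes it below -/
import Mathlib

section
/- Let Q ⊆ ℂⁿ be an open complete circular domain containing 0 (i.e., for every z ∈ Q and every ξ ∈ ℂ with |ξ| ≤ 1 one has ξ•z ∈ Q). Let f be holomorphic on Q with |f(z)| < 1 for all z ∈ Q, and suppose f(z) = Σ_{k=0}^∞ P_k(z) on Q, where each P_k is a homogeneous polynomial map of degree k (so P_k(ξ•z) = ξ^k P_k(z)) and P_0 = f(0). Let a = |f(0)| and let p ∈ (0,2]. Then for every w ∈ Q and every r with 0 ≤ r ≤ r_p(a) := (1 − a^p)/(2 − a² − a^p), one has a^p + Σ_{k=1}^∞ |P_k(r•w)| + (1/(1+a) + r/(1−r)) · Σ_{k=1}^∞ |P_k(r•w)|² ≤ 1. -/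
/-- `h` is a continuous function whose mean over `[0, 2π]` is `c`. -/
def HasMean (h : ℝ → ℂ) (c : ℂ) : Prop :=
  Continuous h ∧ ∫ θ in (0 : ℝ)..(2 * Real.pi), h θ = 2 * Real.pi * c

/-- The character `θ ↦ exp (k θ i)`. -/
noncomputable def expChar (k : ℤ) (θ : ℝ) : ℂ := Complex.exp (k * θ * Complex.I)

lemma continuous_expChar (k : ℤ) : Continuous (expChar k) := by
  unfold expChar
  fun_prop

lemma expChar_add (k l : ℤ) (θ : ℝ) : expChar (k + l) θ = expChar k θ * expChar l θ := by
  simp only [expChar, ← Complex.exp_add]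
  congr 1
  push_cast
  ring

lemma expChar_zero (θ : ℝ) : expChar 0 θ = 1 := by simp [expChar]

lemma conj_expChar (k : ℤ) (θ : ℝ) : (starRingEnd ℂ) (expChar k θ) = expChar (-k) θ := by
  simp [expChar, ← Complex.exp_conj]

lemma norm_expChar (k : ℤ) (θ : ℝ) : ‖expChar k θ‖ = 1 := by
  have := Complex.norm_exp_ofReal_mul_I (k * θ)
  simpa [expChar] using this

lemma expChar_natCast (k : ℕ) (θ : ℝ) : expChar k θ = expChar 1 θ ^ k := by
  simp only [expChar, ← Complex.exp_nat_mul]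
  congr 1
  push_cast
  ring

namespace HasMean

lemma add {h₁ h₂ : ℝ → ℂ} {c₁ c₂ : ℂ} (H₁ : HasMean h₁ c₁) (H₂ : HasMean h₂ c₂) :
    HasMean (fun θ => h₁ θ + h₂ θ) (c₁ + c₂) := by
  refine ⟨H₁.1.add H₂.1, ?_⟩
  rw [intervalIntegral.integral_add (H₁.1.intervalIntegrable _ _)
    (H₂.1.intervalIntegrable _ _), H₁.2, H₂.2]
  ring

lemma const_mul {h : ℝ → ℂ} {c : ℂ} (H : HasMean h c) (u : ℂ) :
    HasMean (fun θ => u * h θ) (u * c) := by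
  refine ⟨continuous_const.mul H.1, ?_⟩
  rw [intervalIntegral.integral_const_mul, H.2]
  ring

lemma sum {ι : Type*} (s : Finset ι) {h : ι → ℝ → ℂ} {c : ι → ℂ}
    (H : ∀ i ∈ s, HasMean (h i) (c i)) :
    HasMean (fun θ => ∑ i ∈ s, h i θ) (∑ i ∈ s, c i) := by
  refine ⟨continuous_finsetSum _ fun i hi => (H i hi).1, ?_⟩
  rw [intervalIntegral.integral_finsetSum fun i hi => (H i hi).1.intervalIntegrable _ _,
    Finset.mul_sum]
  exact Finset.sum_congr rfl fun i hi => (H i hi).2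

lemma re_le {h₁ h₂ : ℝ → ℂ} {c₁ c₂ : ℂ} (H₁ : HasMean h₁ c₁) (H₂ : HasMean h₂ c₂)
    (hle : ∀ θ, (h₁ θ).re ≤ (h₂ θ).re) : c₁.re ≤ c₂.re := by
  have key {h : ℝ → ℂ} {c : ℂ} (H : HasMean h c) :
      ∫ θ in (0 : ℝ)..(2 * Real.pi), (h θ).re = 2 * Real.pi * c.re := by
    have h1 := Complex.reCLM.intervalIntegral_comp_comm
      (H.1.intervalIntegrable (μ := MeasureTheory.volume) 0 (2 * Real.pi))
    rw [H.2] at h1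
    simpa using h1
  have hpi : (0 : ℝ) < 2 * Real.pi := by positivity
  have := intervalIntegral.integral_mono_on (μ := MeasureTheory.volume) hpi.le
    ((Complex.continuous_re.comp H₁.1).intervalIntegrable _ _)
    ((Complex.continuous_re.comp H₂.1).intervalIntegrable _ _) (fun θ _ => hle θ)
  simp only [Function.comp_apply] at this
  rw [key H₁, key H₂] at this
  exact le_of_mul_le_mul_left this hpi

lemma expChar (k : ℤ) : HasMean (expChar k) (if k = 0 then 1 else 0) := by
  refine ⟨continuous_expChar k, ?_⟩
  split_ifs with hk
  · subst hk
    simp [expChar_zero]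
  · have hc : (k * Complex.I : ℂ) ≠ 0 := by simp [hk]
    have h1 := integral_exp_mul_complex (a := 0) (b := 2 * Real.pi) hc
    have h2 : Complex.exp (k * Complex.I * ((2 * Real.pi : ℝ) : ℂ)) = 1 := by
      rw [Complex.exp_eq_one_iff]
      exact ⟨k, by push_cast; ring⟩
    rw [h2] at h1
    simp only [Complex.ofReal_zero, mul_zero, Complex.exp_zero, sub_self, zero_div] at h1
    rw [mul_zero, ← h1]
    refine intervalIntegral.integral_congr fun θ _ => ?_
    simp only [_root_.expChar]
    congr 1
    ring

lemma tsum_mul_expChar {b : ℕ → ℂ} (hb : Summable fun k => ‖b k‖) (m : ℤ) :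
    HasMean (fun θ => (∑' k : ℕ, b k * _root_.expChar k θ) * _root_.expChar (-m) θ)
      (if 0 ≤ m then b m.toNat else 0) := by
  have hcont : Continuous fun θ => ∑' k : ℕ, b k * _root_.expChar k θ :=
    continuous_tsum (fun k => continuous_const.mul (continuous_expChar k)) hb
      (fun k θ => by simp [norm_expChar])
  refine ⟨hcont.mul (continuous_expChar _), ?_⟩
  have hs : HasSum
      (fun k : ℕ => ∫ θ in (0 : ℝ)..(2 * Real.pi), b k * _root_.expChar (k - m) θ)
      (∫ θ in (0 : ℝ)..(2 * Real.pi),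
        (∑' k : ℕ, b k * _root_.expChar k θ) * _root_.expChar (-m) θ) := by
    refine intervalIntegral.hasSum_integral_of_dominated_convergence (fun k _ => ‖b k‖)
      (fun k => (continuous_const.mul (continuous_expChar _)).aestronglyMeasurable)
      (fun k => Filter.Eventually.of_forall fun θ _ => by simp [norm_expChar])
      (Filter.Eventually.of_forall fun θ _ => hb)
      intervalIntegrable_const
      (Filter.Eventually.of_forall fun θ _ => ?_)
    have h1 : Summable fun k : ℕ => b k * _root_.expChar k θ :=
      Summable.of_norm (by simpa [norm_expChar] using hb)
    have h2 := h1.hasSum.mul_right (_root_.expChar (-m) θ)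
    simpa only [sub_eq_add_neg, expChar_add, mul_assoc] using h2
  have hval (k : ℕ) : ∫ θ in (0 : ℝ)..(2 * Real.pi), b k * _root_.expChar (k - m) θ =
      2 * Real.pi * (if (k : ℤ) - m = 0 then b k else 0) := by
    rw [((HasMean.expChar (k - m)).const_mul (b k)).2]
    simp
  simp only [hval] at hs
  refine hs.unique ?_
  split_ifs with hm
  · have h1 := hasSum_ite_eq m.toNat (2 * Real.pi * b m.toNat : ℂ)
    convert h1 using 2 with k
    by_cases hk : k = m.toNat
    · subst hk
      simp [hm]
    · rw [if_neg hk, if_neg (by omega), mul_zero]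
  · have h1 : (fun k : ℕ => (2 * Real.pi * (if (k : ℤ) - m = 0 then b k else 0) : ℂ)) =
        fun _ => 0 := by
      funext k
      rw [if_neg (by omega), mul_zero]
    rw [h1, mul_zero]
    exact hasSum_zero

end HasMean

open ComplexConjugate in
/-- Integrated form of `Re (g τ̄ (1 + τ W̄)²) ≤ |1 + τ W̄|²` on the unit circle, for
`g = ∑ b_k z^k` bounded by one, `τ = t z^N` and a polynomial `W = ∑_{j ≤ m} w_j z^j`. -/
lemma re_coeff_add_le {b : ℕ → ℂ} (hb : Summable fun k => ‖b k‖)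
    (hg : ∀ θ : ℝ, ‖∑' k : ℕ, b k * expChar k θ‖ ≤ 1) {t : ℂ} (ht : ‖t‖ = 1)
    {m N : ℕ} (hmN : m < N) (w : ℕ → ℂ) :
    (conj t * b N + 2 * ∑ j ∈ Finset.range (m + 1), conj (w j) * b j +
      ∑ i ∈ Finset.range (m + 1), ∑ j ∈ Finset.range (m + 1),
        t * conj (w i) * conj (w j) * (if N ≤ i + j then b (i + j - N) else 0)).re ≤
      1 + ∑ j ∈ Finset.range (m + 1), ‖w j‖ ^ 2 := by
  set s := Finset.range (m + 1) with hs
  set g : ℝ → ℂ := fun θ => ∑' k : ℕ, b k * expChar k θ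
  have hB (k : ℤ) := HasMean.tsum_mul_expChar hb k
  have H₁ := (((hB N).const_mul (conj t)).add
    ((HasMean.sum s fun j _ => (hB j).const_mul (conj (w j))).const_mul 2)).add
    (HasMean.sum s fun i _ => HasMean.sum s fun j _ =>
      (hB (i + j - N)).const_mul (t * conj (w i) * conj (w j)))
  have H₂ := (((HasMean.expChar 0).add
    (HasMean.sum s fun j _ => (HasMean.expChar (N - j)).const_mul (t * conj (w j)))).add
    (HasMean.sum s fun j _ => (HasMean.expChar (j - N)).const_mul (conj t * w j))).add
    (HasMean.sum s fun i _ => HasMean.sum s fun j _ =>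
      (HasMean.expChar (i - j)).const_mul (w i * conj (w j)))
  have htt : t * conj t = 1 := by
    rw [Complex.mul_conj, Complex.normSq_eq_norm_sq, ht]
    simp
  have hle := H₁.re_le H₂ fun θ => by
    set W : ℂ := ∑ j ∈ s, w j * expChar j θ with hW
    have hcW : conj W = ∑ j ∈ s, conj (w j) * expChar (-j) θ := by
      simp [hW, map_sum, conj_expChar]
    set E := expChar N θ with hE
    set F := expChar (-N) θ with hF
    have hEF : E * F = 1 := by rw [hE, hF, ← expChar_add]; simp [expChar_zero]
    have hcE : conj E = F := conj_expChar _ _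
    have e1 : conj t * (g θ * expChar (-(N : ℤ)) θ) +
        2 * ∑ j ∈ s, conj (w j) * (g θ * expChar (-(j : ℤ)) θ) +
        ∑ i ∈ s, ∑ j ∈ s, t * conj (w i) * conj (w j) *
          (g θ * expChar (-((i : ℤ) + j - N)) θ) =
        g θ * (conj t * F) * (1 + t * E * conj W) ^ 2 := by
      have a1 : ∑ j ∈ s, conj (w j) * (g θ * expChar (-(j : ℤ)) θ) = g θ * conj W := by
        rw [hcW, Finset.mul_sum]
        exact Finset.sum_congr rfl fun j _ => by ring
      have a2 : ∑ i ∈ s, ∑ j ∈ s, t * conj (w i) * conj (w j) *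
          (g θ * expChar (-((i : ℤ) + j - N)) θ) = g θ * t * E * (conj W * conj W) := by
        rw [hcW, Finset.sum_mul_sum, Finset.mul_sum]
        refine Finset.sum_congr rfl fun i _ => ?_
        rw [Finset.mul_sum]
        refine Finset.sum_congr rfl fun j _ => ?_
        rw [show (-((i : ℤ) + j - N)) = N + (-i + -j) by ring, expChar_add, expChar_add]
        ring
      rw [a1, a2]
      linear_combination
        (-2 * g θ * conj W * (t * conj t) - g θ * t * E * conj W ^ 2 * (t * conj t)) * hEF +
        (-2 * g θ * conj W - g θ * t * E * conj W ^ 2) * htt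
    have e2 : expChar 0 θ + ∑ j ∈ s, t * conj (w j) * expChar ((N : ℤ) - j) θ +
        ∑ j ∈ s, conj t * w j * expChar ((j : ℤ) - N) θ +
        ∑ i ∈ s, ∑ j ∈ s, w i * conj (w j) * expChar ((i : ℤ) - j) θ =
        (1 + t * E * conj W) * conj (1 + t * E * conj W) := by
      have a1 : ∑ j ∈ s, t * conj (w j) * expChar ((N : ℤ) - j) θ = t * E * conj W := by
        rw [hcW, Finset.mul_sum]
        refine Finset.sum_congr rfl fun j _ => ?_
        rw [sub_eq_add_neg, expChar_add]
        ring
      have a2 : ∑ j ∈ s, conj t * w j * expChar ((j : ℤ) - N) θ = conj t * F * W := by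
        rw [hW, Finset.mul_sum]
        refine Finset.sum_congr rfl fun j _ => ?_
        rw [sub_eq_add_neg, expChar_add]
        ring
      have a3 : ∑ i ∈ s, ∑ j ∈ s, w i * conj (w j) * expChar ((i : ℤ) - j) θ =
          W * conj W := by
        rw [hcW, hW, Finset.sum_mul_sum]
        refine Finset.sum_congr rfl fun i _ => Finset.sum_congr rfl fun j _ => ?_
        rw [sub_eq_add_neg, expChar_add]
        ring
      rw [a1, a2, a3, expChar_zero]
      simp only [map_add, map_mul, map_one, Complex.conj_conj, hcE]
      linear_combination (-W * conj W) * htt - W * conj W * t * conj t * hEF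
    refine (congrArg Complex.re e1).trans_le (le_trans ?_ (congrArg Complex.re e2).ge)
    rw [Complex.mul_conj, Complex.normSq_eq_norm_sq, Complex.ofReal_re]
    refine (Complex.re_le_norm _).trans ?_
    have hF1 : ‖F‖ = 1 := norm_expChar _ _
    rw [norm_mul, norm_mul, norm_mul, norm_pow, hF1, Complex.norm_conj, ht]
    simpa using mul_le_mul_of_nonneg_right (hg θ) (sq_nonneg ‖1 + t * E * conj W‖)
  convert hle using 1
  · refine congrArg Complex.re (congrArg₂ _ (by simp) ?_)
    refine Finset.sum_congr rfl fun i _ => Finset.sum_congr rfl fun j _ => congrArg _ ?_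
    by_cases h : N ≤ i + j
    · rw [if_pos h, if_pos (by omega)]
      congr 1
      omega
    · rw [if_neg h, if_neg (by omega)]
  · have z1 : ∑ j ∈ s, t * conj (w j) * (if (N : ℤ) - j = 0 then 1 else 0) = 0 :=
      Finset.sum_eq_zero fun j hj => by
        rw [hs, Finset.mem_range] at hj
        rw [if_neg (by omega), mul_zero]
    have z2 : ∑ j ∈ s, conj t * w j * (if (j : ℤ) - N = 0 then 1 else 0) = 0 :=
      Finset.sum_eq_zero fun j hj => by
        rw [hs, Finset.mem_range] at hj
        rw [if_neg (by omega), mul_zero]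
    have z3 : ∑ i ∈ s, ∑ j ∈ s, w i * conj (w j) * (if (i : ℤ) - j = 0 then 1 else 0) =
        ∑ j ∈ s, ((‖w j‖ ^ 2 : ℝ) : ℂ) := by
      refine Finset.sum_congr rfl fun i hi => ?_
      rw [Finset.sum_eq_single_of_mem i hi fun j _ hj => by
        rw [if_neg (by omega), mul_zero]]
      rw [if_pos (by ring), mul_one, Complex.mul_conj, Complex.normSq_eq_norm_sq]
    rw [z1, z2, z3, ← Complex.ofReal_sum]
    simp only [if_true, add_zero, Complex.add_re, Complex.one_re, Complex.ofReal_re]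

/-- A unimodular `t` with `t̄ z = |z|`. -/
lemma exists_norm_eq_one_conj_mul (z : ℂ) :
    ∃ t : ℂ, ‖t‖ = 1 ∧ (starRingEnd ℂ) t * z = ‖z‖ := by
  by_cases hz : z = 0
  · exact ⟨1, by simp, by simp [hz]⟩
  · have hn : (‖z‖ : ℂ) ≠ 0 := by simpa using hz
    refine ⟨z / ‖z‖, by simp [hz], ?_⟩
    rw [map_div₀, Complex.conj_ofReal, div_mul_eq_mul_div, mul_comm, Complex.mul_conj,
      Complex.normSq_eq_norm_sq]
    field_simp
    push_cast
    ring

/-- Carlson's coefficient inequality, odd index. -/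
lemma norm_coeff_odd_le {b : ℕ → ℂ} (hb : Summable fun k => ‖b k‖)
    (hg : ∀ θ : ℝ, ‖∑' k : ℕ, b k * expChar k θ‖ ≤ 1) (n : ℕ) :
    ‖b (2 * n + 1)‖ ≤ 1 - ∑ j ∈ Finset.range (n + 1), ‖b j‖ ^ 2 := by
  obtain ⟨t, ht, htb⟩ := exists_norm_eq_one_conj_mul (b (2 * n + 1))
  have h := re_coeff_add_le hb hg ht (m := n) (N := 2 * n + 1) (by omega) b
  have h0 : ∑ i ∈ Finset.range (n + 1), ∑ j ∈ Finset.range (n + 1),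
      t * (starRingEnd ℂ) (b i) * (starRingEnd ℂ) (b j) *
        (if 2 * n + 1 ≤ i + j then b (i + j - (2 * n + 1)) else 0) = 0 :=
    Finset.sum_eq_zero fun i hi => Finset.sum_eq_zero fun j hj => by
      rw [Finset.mem_range] at hi hj
      rw [if_neg (by omega), mul_zero]
  have h1 : ∑ j ∈ Finset.range (n + 1), (starRingEnd ℂ) (b j) * b j =
      ((∑ j ∈ Finset.range (n + 1), ‖b j‖ ^ 2 : ℝ) : ℂ) := by
    push_cast
    exact Finset.sum_congr rfl fun j _ => Complex.conj_mul' _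
  rw [h0, h1, htb, add_zero, Complex.add_re, Complex.ofReal_re,
    show (2 : ℂ) = ((2 : ℝ) : ℂ) by norm_num, Complex.re_ofReal_mul,
    Complex.ofReal_re] at h
  linarith

/-- Carlson's coefficient inequality, even index. -/
lemma norm_coeff_even_le {b : ℕ → ℂ} (hb : Summable fun k => ‖b k‖)
    (hg : ∀ θ : ℝ, ‖∑' k : ℕ, b k * expChar k θ‖ ≤ 1) {n : ℕ} (hn : 0 < n) :
    ‖b (2 * n)‖ ≤ 1 - ∑ j ∈ Finset.range n, ‖b j‖ ^ 2 - ‖b n‖ ^ 2 / (1 + ‖b 0‖) := by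
  obtain ⟨t, ht, htb⟩ := exists_norm_eq_one_conj_mul (b (2 * n))
  set x : ℝ := 1 / (1 + ‖b 0‖) with hx
  have hx0 : 0 < 1 + ‖b 0‖ := by positivity
  have hx1 : x * (1 + ‖b 0‖) = 1 := by rw [hx]; field_simp
  set w : ℕ → ℂ := fun j => if j = n then x * b n else b j with hw
  have hwn : w n = x * b n := by simp [hw]
  have hwj {j : ℕ} (hj : j ∈ Finset.range n) : w j = b j := by
    rw [Finset.mem_range] at hj
    simp [hw, hj.ne]
  have h := re_coeff_add_le hb hg ht (m := n) (N := 2 * n) (by omega) w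
  have h0 : ∑ i ∈ Finset.range (n + 1), ∑ j ∈ Finset.range (n + 1),
      t * (starRingEnd ℂ) (w i) * (starRingEnd ℂ) (w j) *
        (if 2 * n ≤ i + j then b (i + j - 2 * n) else 0) =
      t * (starRingEnd ℂ) (w n) * (starRingEnd ℂ) (w n) * b 0 := by
    rw [Finset.sum_eq_single_of_mem n (by simp) fun i hi hin =>
      Finset.sum_eq_zero fun j hj => by
        rw [Finset.mem_range] at hi hj
        rw [if_neg (by omega), mul_zero]]
    rw [Finset.sum_eq_single_of_mem n (by simp) fun j hj hjn => by
      rw [Finset.mem_range] at hj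
      rw [if_neg (by omega), mul_zero]]
    rw [if_pos (by omega), show n + n - 2 * n = 0 by omega]
  have h1 : ∑ j ∈ Finset.range (n + 1), (starRingEnd ℂ) (w j) * b j =
      ((∑ j ∈ Finset.range n, ‖b j‖ ^ 2 + x * ‖b n‖ ^ 2 : ℝ) : ℂ) := by
    rw [Finset.sum_range_succ, hwn]
    push_cast
    congr 1
    · exact Finset.sum_congr rfl fun j hj => by rw [hwj hj, Complex.conj_mul']
    · rw [map_mul, Complex.conj_ofReal, mul_assoc, Complex.conj_mul']
  have h2 : ∑ j ∈ Finset.range (n + 1), ‖w j‖ ^ 2 =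
      ∑ j ∈ Finset.range n, ‖b j‖ ^ 2 + x ^ 2 * ‖b n‖ ^ 2 := by
    rw [Finset.sum_range_succ, hwn, norm_mul, mul_pow, Complex.norm_real, Real.norm_eq_abs,
      sq_abs]
    congr 1
    exact Finset.sum_congr rfl fun j hj => by rw [hwj hj]
  have h3 : -(x ^ 2 * ‖b n‖ ^ 2 * ‖b 0‖) ≤
      (t * (starRingEnd ℂ) (w n) * (starRingEnd ℂ) (w n) * b 0).re := by
    have h4 := (abs_le.mp (Complex.abs_re_le_norm
      (t * (starRingEnd ℂ) (w n) * (starRingEnd ℂ) (w n) * b 0))).1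
    refine le_trans (le_of_eq ?_) h4
    rw [norm_mul, norm_mul, norm_mul, ht, Complex.norm_conj, hwn, norm_mul,
      Complex.norm_real, Real.norm_eq_abs, ← sq_abs x]
    ring
  rw [h0, h1, h2, htb, Complex.add_re, Complex.add_re, Complex.ofReal_re,
    show (2 : ℂ) = ((2 : ℝ) : ℂ) by norm_num, Complex.re_ofReal_mul, Complex.ofReal_re] at h
  have h5 : x ^ 2 * ‖b n‖ ^ 2 + x ^ 2 * ‖b n‖ ^ 2 * ‖b 0‖ = x * ‖b n‖ ^ 2 := by
    linear_combination x * ‖b n‖ ^ 2 * hx1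
  have h6 : ‖b n‖ ^ 2 / (1 + ‖b 0‖) = x * ‖b n‖ ^ 2 := by rw [hx]; ring
  rw [h6]
  linarith

/-- Summation of Carlson's inequalities. -/
lemma sum_range_add_le_of_carlson {c : ℕ → ℝ} {r : ℝ} (hr0 : 0 ≤ r) (hr1 : r < 1)
    (hodd : ∀ n, c (2 * n + 1) ≤ 1 - ∑ j ∈ Finset.range (n + 1), c j ^ 2)
    (heven : ∀ n, 0 < n →
      c (2 * n) ≤ 1 - ∑ j ∈ Finset.range n, c j ^ 2 - c n ^ 2 / (1 + c 0)) (M : ℕ) :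
    ∑ k ∈ Finset.range (2 * M), r ^ (k + 1) * c (k + 1) +
      (1 / (1 + c 0) + r / (1 - r)) *
        ∑ k ∈ Finset.range M, (r ^ (k + 1) * c (k + 1)) ^ 2 ≤
      r / (1 - r) * (1 - c 0 ^ 2 -
        r ^ (2 * M) * (1 - ∑ j ∈ Finset.range (M + 1), c j ^ 2)) := by
  have h1r : 1 - r ≠ 0 := by linarith
  induction M with
  | zero => simp
  | succ M ih =>
    rw [show 2 * (M + 1) = 2 * M + 1 + 1 by ring, Finset.sum_range_succ,
      Finset.sum_range_succ, Finset.sum_range_succ _ M, Finset.sum_range_succ _ (M + 1)]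
    have ho := mul_le_mul_of_nonneg_left (hodd M) (pow_nonneg hr0 (2 * M + 1))
    have he := mul_le_mul_of_nonneg_left (heven (M + 1) M.succ_pos)
      (pow_nonneg hr0 (2 * M + 1 + 1))
    rw [show 2 * (M + 1) = 2 * M + 1 + 1 by ring] at he
    set S := ∑ j ∈ Finset.range (M + 1), c j ^ 2
    have key : r / (1 - r) * (1 - c 0 ^ 2 -
        r ^ (2 * M + 1 + 1) * (1 - (S + c (M + 1) ^ 2))) =
        r / (1 - r) * (1 - c 0 ^ 2 - r ^ (2 * M) * (1 - S)) +
        r ^ (2 * M + 1) * (1 - S) +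
        r ^ (2 * M + 1 + 1) * (1 - S - c (M + 1) ^ 2 / (1 + c 0)) +
        (1 / (1 + c 0) + r / (1 - r)) * (r ^ (M + 1) * c (M + 1)) ^ 2 := by
      field_simp
      ring
    rw [key]
    linarith

/-- Multidimensional refined Bohr inequality (Theorem 1 of Liu–Ponnusamy):
if `Q ⊆ ℂⁿ` is an open complete circular domain containing `0`, `f` is holomorphic on `Q`
with `|f| < 1`, expanded as `f = Σ_k P_k` with `P_k` homogeneous of degree `k` and
`P_0 = f(0)`, `p ∈ (0,2]`, then for `w ∈ Q` and `0 ≤ r ≤ r_p(a) = (1-a^p)/(2-a²-a^p)`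
with `a = |f(0)|`, one has
`a^p + Σ_{k≥1} |P_k(r•w)| + (1/(1+a) + r/(1-r)) Σ_{k≥1} |P_k(r•w)|² ≤ 1`. -/
theorem stmt_0 (n : ℕ) (Q : Set (Fin n → ℂ)) (hQopen : IsOpen Q)
    (h0Q : (0 : Fin n → ℂ) ∈ Q)
    (hcirc : ∀ z ∈ Q, ∀ ξ : ℂ, ‖ξ‖ ≤ 1 → ξ • z ∈ Q)
    (f : (Fin n → ℂ) → ℂ) (hf : DifferentiableOn ℂ f Q)
    (hb : ∀ z ∈ Q, ‖f z‖ < 1)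
    (P : ℕ → (Fin n → ℂ) → ℂ)
    (hhom : ∀ (k : ℕ) (ξ : ℂ) (z : Fin n → ℂ), P k (ξ • z) = ξ ^ k * P k z)
    (hP0 : ∀ z : Fin n → ℂ, P 0 z = f 0)
    (hsum : ∀ z ∈ Q, HasSum (fun k : ℕ => P k z) (f z))
    (p : ℝ) (hp0 : 0 < p) (hp2 : p ≤ 2)
    (w : Fin n → ℂ) (hw : w ∈ Q) (r : ℝ) (hr0 : 0 ≤ r)
    (hr : r ≤ (1 - ‖f 0‖ ^ p) / (2 - ‖f 0‖ ^ 2 - ‖f 0‖ ^ p)) :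
    Summable (fun k : ℕ => ‖P (k + 1) ((r : ℂ) • w)‖) ∧
    Summable (fun k : ℕ => ‖P (k + 1) ((r : ℂ) • w)‖ ^ 2) ∧
    ‖f 0‖ ^ p + (∑' k : ℕ, ‖P (k + 1) ((r : ℂ) • w)‖) +
      (1 / (1 + ‖f 0‖) + r / (1 - r)) *
        ∑' k : ℕ, ‖P (k + 1) ((r : ℂ) • w)‖ ^ 2 ≤ 1 := by
  set a := ‖f 0‖ with ha
  have ha0 : 0 ≤ a := norm_nonneg _
  have ha1 : a < 1 := hb 0 h0Q
  have hap : a ^ p < 1 := Real.rpow_lt_one ha0 ha1 hp0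
  have ha2 : a ^ 2 < 1 := by nlinarith
  have hden : 0 < 2 - a ^ 2 - a ^ p := by linarith
  rw [le_div_iff₀ hden] at hr
  have hr1 : r < 1 := by nlinarith
  have hquot : r / (1 - r) * (1 - a ^ 2) ≤ 1 - a ^ p := by
    rw [div_mul_eq_mul_div, div_le_iff₀ (by linarith)]
    linarith
  have hsummable : Summable fun k => ‖P k w‖ := (hsum w hw).summable.norm
  have hcircle (θ : ℝ) : ‖∑' k : ℕ, P k w * expChar k θ‖ ≤ 1 := by
    have hmem := hcirc w hw (expChar 1 θ) (norm_expChar 1 θ).le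
    have h1 := (hsum _ hmem).tsum_eq
    simp only [hhom] at h1
    simp only [expChar_natCast, mul_comm (P _ w), h1]
    exact (hb _ hmem).le
  have hterm (k : ℕ) : ‖P k ((r : ℂ) • w)‖ = r ^ k * ‖P k w‖ := by
    rw [hhom, norm_mul, norm_pow, Complex.norm_real, Real.norm_eq_abs, abs_of_nonneg hr0]
  have hmemr : (r : ℂ) • w ∈ Q := hcirc w hw r (by
    rw [Complex.norm_real, Real.norm_eq_abs, abs_of_nonneg hr0]
    exact hr1.le)
  have hs1 : Summable fun k : ℕ => ‖P (k + 1) ((r : ℂ) • w)‖ :=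
    (summable_nat_add_iff 1).mpr (hsum _ hmemr).summable.norm
  have hs2 : Summable fun k : ℕ => ‖P (k + 1) ((r : ℂ) • w)‖ ^ 2 := by
    have := hs1.mul_of_nonneg hs1 (fun _ => norm_nonneg _) (fun _ => norm_nonneg _)
    simpa only [sq, Function.comp_def] using this.comp_injective (i := fun k : ℕ => (k, k))
      fun _ _ h => congrArg Prod.fst h
  refine ⟨hs1, hs2, ?_⟩
  have hlim := (hs1.hasSum.tendsto_sum_nat.comp
    (Filter.tendsto_id.const_mul_atTop' (r := 2) two_pos)).add
    (hs2.hasSum.tendsto_sum_nat.const_mul (1 / (1 + a) + r / (1 - r)))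
  have hodd := norm_coeff_odd_le hsummable hcircle
  have hle := le_of_tendsto' hlim (b := 1 - a ^ p) fun M => by
    have h1 := sum_range_add_le_of_carlson (c := fun k => ‖P k w‖) hr0 hr1 hodd
      (fun n hn => norm_coeff_even_le hsummable hcircle hn) M
    simp only [hP0, ← ha, ← hterm] at h1
    refine h1.trans (le_trans ?_ hquot)
    have h2 : 0 ≤ 1 - ∑ j ∈ Finset.range (M + 1), ‖P j w‖ ^ 2 :=
      (norm_nonneg _).trans (hodd M)
    have h3 := mul_nonneg (pow_nonneg hr0 (2 * M)) h2
    exact mul_le_mul_of_nonneg_left (by linarith) (div_nonneg hr0 (by linarith))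
  linarith
end

section
/- Let n ≥ 1 and let f(z) = Σ_α c_α z^α be a holomorphic function on the unit polydisk 𝔻ⁿ with f(0) = 0 and |f(z)| < 1 on 𝔻ⁿ. Then for every z ∈ ℂⁿ with |z_j| ≤ 1/√(2n) for all j, one has Σ_{α ≠ 0} |c_α| |z^α| ≤ 1. (Consequently the Bohr radius K_n⁰ for such functions satisfies K_n⁰ ≥ 1/√(2n).) -/
open MeasureTheory Filter Topology

section Bessel

variable {ι H : Type*} [NormedAddCommGroup H] [InnerProductSpace ℂ H]

/-- Bessel's inequality for the coefficients of an expansion along an orthonormal family. -/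
theorem Orthonormal.sum_sq_norm_le_of_hasSum {v : ι → H} (hv : Orthonormal ℂ v) {a : ι → ℂ} {x : H}
    (h : HasSum (fun i => a i • v i) x) (s : Finset ι) : ∑ i ∈ s, ‖a i‖ ^ 2 ≤ ‖x‖ ^ 2 := by
  classical
  have key (i : ι) : inner ℂ (v i) x = a i := by
    have h₁ := (innerSL ℂ (v i)).hasSum h
    have h₂ : HasSum (fun j => innerSL ℂ (v i) (a j • v j)) (a i) := by
      convert hasSum_ite_eq i (a i) using 2 with j
      simp only [innerSL_apply_apply, inner_smul_right, orthonormal_iff_ite.mp hv i j]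
      by_cases hij : i = j
      · subst hij; simp
      · simp [hij, Ne.symm hij]
    exact h₁.unique h₂
  simpa only [key] using hv.sum_inner_products_le x (s := s)

end Bessel

section Torus

/-- The circle `ℝ / ℤ` carries its Haar probability measure. -/
noncomputable local instance : MeasureSpace UnitAddCircle := ⟨AddCircle.haarAddCircle⟩

local instance : IsProbabilityMeasure (volume : Measure UnitAddCircle) :=
  inferInstanceAs (IsProbabilityMeasure AddCircle.haarAddCircle)

/-- The Fourier coefficients of an absolutely convergent trigonometric series which is bounded
by `1` are square summable, with sum at most `1`. -/
theorem UnitAddTorus.sum_sq_norm_le_one {ι d : Type*} [Fintype d] {m : ι → d → ℤ}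
    (hm : Function.Injective m) {a : ι → ℂ} (ha : Summable fun i => ‖a i‖)
    (hbound : ∀ x, ‖∑' i, a i * UnitAddTorus.mFourier (m i) x‖ ≤ 1) (s : Finset ι) :
    ∑ i ∈ s, ‖a i‖ ^ 2 ≤ 1 := by
  have hs : Summable fun i => a i • UnitAddTorus.mFourier (m i) := by
    refine Summable.of_norm ?_
    simpa [norm_smul, UnitAddTorus.mFourier_norm] using ha
  obtain ⟨F, hF⟩ := hs
  have hF1 : ‖F‖ ≤ 1 := by
    refine (ContinuousMap.norm_le _ zero_le_one).mpr fun x => ?_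
    have h := (ContinuousMap.evalCLM ℂ x).hasSum hF
    have h' : HasSum (fun i => a i * UnitAddTorus.mFourier (m i) x) (F x) := h
    rw [← h'.tsum_eq]
    exact hbound x
  have hL := (ContinuousMap.toLp (E := ℂ) 2 (volume : Measure (UnitAddTorus d)) ℂ).hasSum hF
  simp only [map_smul] at hL
  refine ((UnitAddTorus.orthonormal_mFourier.comp m hm).sum_sq_norm_le_of_hasSum hL s).trans ?_
  refine pow_le_one₀ (norm_nonneg _) ((ContinuousLinearMap.le_of_opNorm_le _
    (ContinuousMap.toLp_norm_le (μ := volume)) F).trans ?_)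
  simpa [measureUnivNNReal] using hF1

end Torus

/-- Cauchy's estimate in quadratic mean for power series bounded by `1` on the polydisk. -/
theorem sum_sq_norm_coeff_le_one {n : ℕ} {f : (Fin n → ℂ) → ℂ} {c : (Fin n → ℕ) → ℂ}
    (hsum : ∀ z : Fin n → ℂ, (∀ i, ‖z i‖ < 1) →
      HasSum (fun α : Fin n → ℕ => c α * ∏ i, z i ^ α i) (f z))
    (hb : ∀ z : Fin n → ℂ, (∀ i, ‖z i‖ < 1) → ‖f z‖ ≤ 1) (s : Finset (Fin n → ℕ)) :
    ∑ α ∈ s, ‖c α‖ ^ 2 ≤ 1 := by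
  have hr {r : ℝ} (hr0 : 0 < r) (hr1 : r < 1) :
      ∑ α ∈ s, ‖c α * ∏ i, (r : ℂ) ^ α i‖ ^ 2 ≤ 1 := by
    have hinj : Function.Injective fun (α : Fin n → ℕ) (i : Fin n) => (α i : ℤ) :=
      fun α β h => funext fun i => by simpa using congrFun h i
    refine UnitAddTorus.sum_sq_norm_le_one hinj
      (a := fun α => c α * ∏ i, (r : ℂ) ^ α i) ?_ (fun x => ?_) s
    · exact (hsum (fun _ => r) fun _ => by simpa [abs_of_pos hr0] using hr1).summable.norm
    · have hx : ∀ i, ‖(r : ℂ) * AddCircle.toCircle (x i)‖ < 1 := fun i => by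
        rw [norm_mul, Circle.norm_coe, mul_one]
        simpa [abs_of_pos hr0] using hr1
      convert hb _ hx using 2
      rw [← (hsum _ hx).tsum_eq]
      refine tsum_congr fun α => ?_
      simp [UnitAddTorus.mFourier, mul_pow, Finset.prod_mul_distrib, mul_assoc,
        AddCircle.toCircle_nsmul]
  have hlim : Tendsto (fun r : ℝ => ∑ α ∈ s, ‖c α * ∏ i, (r : ℂ) ^ α i‖ ^ 2) (𝓝[<] 1)
      (𝓝 (∑ α ∈ s, ‖c α‖ ^ 2)) := by
    have hc : Continuous fun r : ℝ => ∑ α ∈ s, ‖c α * ∏ i, (r : ℂ) ^ α i‖ ^ 2 := by fun_prop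
    simpa using (hc.tendsto 1).mono_left nhdsWithin_le_nhds
  refine le_of_tendsto hlim ?_
  filter_upwards [Ioo_mem_nhdsLT (zero_lt_one' ℝ)] with r hr'
  exact hr hr'.1 hr'.2

/-- Finite sums of monomials are bounded by the product of the geometric series. -/
theorem sum_prod_pow_le_inv_pow {ι : Type*} [Fintype ι] {x : ι → ℝ} {q : ℝ}
    (hx : ∀ i, 0 ≤ x i) (hxq : ∀ i, x i ≤ q) (hq : 0 ≤ q) (hq1 : q < 1)
    (s : Finset (ι → ℕ)) : ∑ α ∈ s, ∏ i, x i ^ α i ≤ (1 - q)⁻¹ ^ Fintype.card ι := by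
  classical
  obtain ⟨N, hN⟩ : ∃ N, s ⊆ Fintype.piFinset fun _ : ι => Finset.range N := by
    refine ⟨(s.sup fun α => Finset.univ.sup α) + 1, fun α hα => ?_⟩
    rw [Fintype.mem_piFinset]
    intro i
    rw [Finset.mem_range, Nat.lt_succ_iff]
    exact (Finset.le_sup (f := α) (Finset.mem_univ i)).trans
      (Finset.le_sup (f := fun α : ι → ℕ => Finset.univ.sup α) hα)
  calc ∑ α ∈ s, ∏ i, x i ^ α i
      ≤ ∑ α ∈ Fintype.piFinset fun _ : ι => Finset.range N, ∏ i, x i ^ α i :=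
        Finset.sum_le_sum_of_subset_of_nonneg hN fun α _ _ =>
          Finset.prod_nonneg fun i _ => pow_nonneg (hx i) _
    _ = ∏ i, ∑ k ∈ Finset.range N, x i ^ k := (Finset.prod_univ_sum _ _).symm
    _ ≤ ∏ _i : ι, (1 - q)⁻¹ := by
        refine Finset.prod_le_prod
          (fun i _ => Finset.sum_nonneg fun k _ => pow_nonneg (hx i) k) fun i _ => ?_
        exact (Finset.sum_le_sum fun k _ => pow_le_pow_left₀ (hx i) (hxq i) k).trans
          ((tsum_geometric_of_lt_one hq hq1) ▸
            (summable_geometric_of_lt_one hq hq1).sum_le_tsum _ fun k _ => pow_nonneg hq k)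
    _ = (1 - q)⁻¹ ^ Fintype.card ι := by simp

theorem inv_one_sub_inv_two_mul_pow_le_two {n : ℕ} (hn : 1 ≤ n) :
    (1 - (2 * n : ℝ)⁻¹)⁻¹ ^ n ≤ 2 := by
  have hn' : (1 : ℝ) ≤ n := by exact_mod_cast hn
  have hq1 : (2 * n : ℝ)⁻¹ ≤ 1 := inv_le_one_of_one_le₀ (by linarith)
  have h := one_add_mul_le_pow (a := -(2 * n : ℝ)⁻¹) (by linarith) n
  have h2 : (1 : ℝ) + n * -(2 * n : ℝ)⁻¹ = 2⁻¹ := by field_simp; norm_num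
  rw [h2, ← sub_eq_add_neg] at h
  rw [inv_pow]
  exact inv_le_of_inv_le₀ two_pos h


/-- Lower bound part of Theorem 3 of Liu–Ponnusamy: if `f(z) = Σ_α c_α z^α` is
holomorphic on the unit polydisk `𝔻ⁿ` (`n ≥ 1`) with `f(0) = 0` and `|f| < 1`,
then for every `z` with `|z_j| ≤ 1/√(2n)` for all `j`, the majorant series satisfies
`Σ_{α ≠ 0} |c_α| |z^α| ≤ 1`; consequently `K_n⁰ ≥ 1/√(2n)`. -/
theorem stmt_3 (n : ℕ) (hn : 1 ≤ n) (f : (Fin n → ℂ) → ℂ) (c : (Fin n → ℕ) → ℂ)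
    (hf : DifferentiableOn ℂ f {z : Fin n → ℂ | ∀ i, ‖z i‖ < 1})
    (hsum : ∀ z : Fin n → ℂ, (∀ i, ‖z i‖ < 1) →
      HasSum (fun α : Fin n → ℕ => c α * ∏ i, z i ^ α i) (f z))
    (hf0 : f 0 = 0)
    (hb : ∀ z : Fin n → ℂ, (∀ i, ‖z i‖ < 1) → ‖f z‖ < 1)
    (z : Fin n → ℂ) (hz : ∀ i, ‖z i‖ ≤ (Real.sqrt (2 * n))⁻¹) :
    Summable (fun α : {α : Fin n → ℕ // α ≠ 0} => ‖c α.1‖ * ∏ i, ‖z i‖ ^ α.1 i) ∧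
    ∑' α : {α : Fin n → ℕ // α ≠ 0}, ‖c α.1‖ * ∏ i, ‖z i‖ ^ α.1 i ≤ 1 := by
  have hn' : (1 : ℝ) ≤ n := by exact_mod_cast hn
  have hq0 : 0 < (2 * n : ℝ)⁻¹ := by positivity
  have hq1 : (2 * n : ℝ)⁻¹ < 1 := inv_lt_one_of_one_lt₀ (by linarith)
  have hz2 (i : Fin n) : ‖z i‖ ^ 2 ≤ (2 * n : ℝ)⁻¹ := by
    refine (pow_le_pow_left₀ (norm_nonneg _) (hz i) 2).trans_eq ?_
    rw [inv_pow, Real.sq_sqrt (by positivity)]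
  have hfin (t : Finset {α : Fin n → ℕ // α ≠ 0}) :
      ∑ α ∈ t, ‖c α.1‖ * ∏ i, ‖z i‖ ^ α.1 i ≤ 1 := by
    set s : Finset (Fin n → ℕ) := t.map (Function.Embedding.subtype _) with hs
    have h0 : (0 : Fin n → ℕ) ∉ s := by simp [hs]
    have hc := sum_sq_norm_coeff_le_one hsum (fun w hw => (hb w hw).le) s
    have hg : ∑ α ∈ s, (∏ i, ‖z i‖ ^ α i) ^ 2 ≤ 1 := by
      have h := (sum_prod_pow_le_inv_pow (fun i => sq_nonneg ‖z i‖) hz2 hq0.le hq1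
        (insert 0 s)).trans (by simpa using inv_one_sub_inv_two_mul_pow_le_two hn)
      rw [Finset.sum_insert h0] at h
      simp only [← Finset.prod_pow, pow_right_comm _ _ 2]
      simp only [Pi.zero_apply, pow_zero, Finset.prod_const_one] at h
      linarith
    have hcs := Finset.sum_mul_sq_le_sq_mul_sq s (fun α => ‖c α‖) fun α => ∏ i, ‖z i‖ ^ α i
    have hle : (∑ α ∈ s, ‖c α‖ * ∏ i, ‖z i‖ ^ α i) ^ 2 ≤ 1 :=
      hcs.trans (mul_le_one₀ hc (Finset.sum_nonneg fun _ _ => sq_nonneg _) hg)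
    have hsum_map : ∑ α ∈ t, ‖c α.1‖ * ∏ i, ‖z i‖ ^ α.1 i
        = ∑ α ∈ s, ‖c α‖ * ∏ i, ‖z i‖ ^ α i := by simp [hs]
    rw [hsum_map]
    exact (abs_le_one_iff_mul_self_le_one.mpr (by rwa [← sq])) |> (le_abs_self _).trans
  have hS := summable_of_sum_le (fun α => by positivity) hfin
  exact ⟨hS, hS.tsum_le_of_sum_le hfin⟩
end

section
/- Let Q ⊆ ℂⁿ be an open complete circular domain containing 0. Let f be holomorphic on Q with |f(z)| < 1 for all z ∈ Q, and suppose f(z) = Σ_{k=0}^∞ P_k(z) on Q, where each P_k is a homogeneous polynomial map of degree k. Let a = |f(0)| < 1, let p > 0, and define A_{a,p}(r) = [1 − (2 − a²)r](1 + a r)^p − (1 − r)(r + a)^p. Then for every w ∈ Q and every r ∈ [0,1) with A_{a,p}(r) ≥ 0, one has |f(r•w)|^p + Σ_{k=1}^∞ |P_k(r•w)| + (1/(1+a) + r/(1−r)) · Σ_{k=1}^∞ |P_k(r•w)|² ≤ 1. -/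
open Complex ComplexConjugate AddCircle MeasureTheory Finset

/-- The analytic Toeplitz matrix of a power series bounded by one on the unit circle is a
contraction. -/
theorem toeplitz_contraction {a : ℕ → ℂ} (ha : Summable fun k => ‖a k‖)
    (hb : ∀ z : ℂ, ‖z‖ = 1 → ‖∑' k, a k * z ^ k‖ ≤ 1) (x : ℕ → ℂ) (S J : Finset ℕ) :
    ∑ i ∈ S, ‖∑ j ∈ J, if j ≤ i then a (i - j) * x j else 0‖ ^ 2 ≤ ∑ j ∈ J, ‖x j‖ ^ 2 := by
  let L := ContinuousMap.toLp (E := ℂ) 2 (haarAddCircle (T := 1)) ℂ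
  have hL : ∀ n : ℤ, L (fourier n) = fourierLp 2 n := fun n => rfl
  have horth := orthonormal_fourier (T := 1)
  have hsum : Summable fun k : ℕ => a k • fourier (T := 1) (k : ℤ) := by
    refine Summable.of_norm ?_
    simpa [norm_smul, fourier_norm] using ha
  let F : C(AddCircle (1 : ℝ), ℂ) := ∑' k : ℕ, a k • fourier (k : ℤ)
  have hFs : HasSum (fun k : ℕ => a k • fourier (T := 1) (k : ℤ)) F := hsum.hasSum
  have hpow : ∀ (k : ℕ) (t : AddCircle (1 : ℝ)), fourier (k : ℤ) t = (fourier 1 t) ^ k := by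
    intro k t
    induction k with
    | zero => simp
    | succ k ih => rw [Nat.cast_succ, fourier_add, ih, pow_succ]
  have hF1 : ∀ t, ‖F t‖ ≤ 1 := by
    intro t
    have h1 : HasSum (fun k : ℕ => a k * fourier 1 t ^ k) (F t) := by
      have := hFs.mapL (ContinuousMap.evalCLM ℂ t)
      simpa [hpow] using this
    rw [← h1.tsum_eq]
    apply hb
    rw [fourier_one, Circle.norm_coe]
  let X : C(AddCircle (1 : ℝ), ℂ) := ∑ j ∈ J, x j • fourier (j : ℤ)
  have hX : ‖L X‖ ^ 2 = ∑ j ∈ J, ‖x j‖ ^ 2 := by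
    have hLX : L X = ∑ j ∈ J, x j • fourierLp 2 (j : ℤ) := by
      simp only [X, map_sum, map_smul, hL]
    have h := (horth.comp (fun n : ℕ => (n : ℤ)) Nat.cast_injective).inner_sum x x J
    simp only [Function.comp_def] at h
    rw [← hLX, inner_self_eq_norm_sq_to_K] at h
    simp only [conj_mul'] at h
    apply ofReal_injective
    push_cast
    exact h
  have hFX : ‖L (F * X)‖ ≤ ‖L X‖ := by
    refine Lp.norm_le_norm_of_ae_le ?_
    filter_upwards [ContinuousMap.coeFn_toLp (E := ℂ) (p := 2) (𝕜 := ℂ) haarAddCircle (F * X),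
      ContinuousMap.coeFn_toLp (E := ℂ) (p := 2) (𝕜 := ℂ) haarAddCircle X] with t h1 h2
    rw [h1, h2, ContinuousMap.mul_apply, norm_mul]
    exact mul_le_of_le_one_left (norm_nonneg _) (hF1 t)
  have hcoef : ∀ i : ℕ, inner ℂ (fourierLp 2 (i : ℤ)) (L (F * X)) =
      ∑ j ∈ J, if j ≤ i then a (i - j) * x j else 0 := by
    intro i
    have hexp : L (F * X) = ∑ j ∈ J, x j • L (F * fourier (j : ℤ)) := by
      simp only [X, mul_sum, mul_smul_comm, map_sum, map_smul]
    rw [hexp, inner_sum]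
    refine sum_congr rfl fun j _ => ?_
    have h1 : HasSum (fun k : ℕ => a k * if (i : ℤ) = k + j then 1 else 0)
        (inner ℂ (fourierLp 2 (i : ℤ)) (L (F * fourier (j : ℤ)))) := by
      have h := ((hFs.mul_right (fourier (j : ℤ))).mapL L).mapL
        (innerSL ℂ (fourierLp 2 (i : ℤ) : Lp ℂ 2 (haarAddCircle (T := 1))))
      refine h.congr_fun ?_
      intro k
      have hm : (fourier (k : ℤ) : C(AddCircle (1 : ℝ), ℂ)) * fourier (j : ℤ) =
          fourier ((k : ℤ) + j) := by
        ext t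
        simp only [ContinuousMap.mul_apply, fourier_add]
      rw [smul_mul_assoc, hm, map_smul, map_smul, hL, innerSL_apply_apply,
        orthonormal_iff_ite.mp horth, smul_eq_mul]
    rw [inner_smul_right, ← h1.tsum_eq]
    split_ifs with hji
    · rw [tsum_eq_single (i - j)]
      · rw [if_pos (by omega)]
        ring
      · intro k hk
        rw [if_neg (by omega), mul_zero]
    · rw [tsum_congr (fun k => by rw [if_neg (by omega), mul_zero]), tsum_zero, mul_zero]
  have hbessel := (horth.comp (fun n : ℕ => (n : ℤ)) Nat.cast_injective).sum_inner_products_le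
    (L (F * X)) (s := S)
  simp only [Function.comp_def, hcoef] at hbessel
  rw [← hX]
  exact hbessel.trans (by gcongr)

/-- The contraction property of the Toeplitz matrix evaluated on the vector
`e₀ + t ∑ wₘ āₘ e_{N-m}`. -/
theorem toeplitz_reflected_vector {a : ℕ → ℂ} (ha : Summable fun k => ‖a k‖)
    (hb : ∀ z : ℂ, ‖z‖ = 1 → ‖∑' k, a k * z ^ k‖ ≤ 1) {K N : ℕ} (hKN : K ≤ N)
    (w : ℕ → ℝ) {t : ℂ} (ht : ‖t‖ = 1) :
    ∑ i ∈ range K, ‖a i + ∑ m ∈ range K,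
        (if N - m ≤ i then a (i - (N - m)) * (t * w m * conj (a m)) else 0)‖ ^ 2 +
      ‖a N + t * ((∑ m ∈ range K, w m * ‖a m‖ ^ 2 : ℝ) : ℂ)‖ ^ 2 ≤
    1 + ∑ m ∈ range K, w m ^ 2 * ‖a m‖ ^ 2 := by
  have h := toeplitz_contraction ha hb
    (fun j => if j = 0 then 1 else t * w (N - j) * conj (a (N - j)))
    (insert N (range K)) (insert 0 ((range K).image fun m => N - m))
  have h0 : (0 : ℕ) ∉ (range K).image fun m => N - m := by
    simp only [mem_image, mem_range, not_exists, not_and]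
    intro m hm
    omega
  have hN : N ∉ range K := by simpa using hKN
  have hinj : Set.InjOn (fun m => N - m) (range K : Set ℕ) := by
    intro m hm m' hm' h
    simp only [coe_range, Set.mem_Iio] at hm hm' h
    omega
  rw [sum_insert hN, sum_insert h0, sum_image hinj] at h
  simp only [sum_insert h0, sum_image hinj] at h
  have hval : ∀ m ∈ range K, (if N - m = 0 then (1 : ℂ)
      else t * w (N - (N - m)) * conj (a (N - (N - m)))) = t * w m * conj (a m) := by
    intro m hm
    rw [mem_range] at hm
    rw [if_neg (by omega), show N - (N - m) = m by omega]
  have e1 : ∑ m ∈ range K, ‖(if N - m = 0 then (1 : ℂ)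
      else t * w (N - (N - m)) * conj (a (N - (N - m))))‖ ^ 2 =
      ∑ m ∈ range K, w m ^ 2 * ‖a m‖ ^ 2 := by
    refine sum_congr rfl fun m hm => ?_
    rw [hval m hm]
    simp [ht, mul_pow]
  have e2 : ∑ m ∈ range K, (if N - m ≤ N then a (N - (N - m)) * (if N - m = 0 then (1 : ℂ)
      else t * w (N - (N - m)) * conj (a (N - (N - m)))) else 0) =
      t * ((∑ m ∈ range K, w m * ‖a m‖ ^ 2 : ℝ) : ℂ) := by
    push_cast
    rw [mul_sum]
    refine sum_congr rfl fun m hm => ?_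
    rw [hval m hm, if_pos (by omega)]
    rw [mem_range] at hm
    rw [show N - (N - m) = m by omega, ← mul_conj']
    ring
  have e3 : ∀ i, ∑ m ∈ range K, (if N - m ≤ i then a (i - (N - m)) * (if N - m = 0 then (1 : ℂ)
      else t * w (N - (N - m)) * conj (a (N - (N - m)))) else 0) = ∑ m ∈ range K,
        (if N - m ≤ i then a (i - (N - m)) * (t * w m * conj (a m)) else 0) := by
    intro i
    refine sum_congr rfl fun m hm => ?_
    rw [hval m hm]
  rw [e1, e2] at h
  simp only [e3] at h
  simp only [zero_le, if_true, tsub_zero, mul_one, norm_one, one_pow] at h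
  linarith

theorem exists_unimodular_mul_norm (c : ℂ) : ∃ t : ℂ, ‖t‖ = 1 ∧ c = t * ‖c‖ := by
  by_cases hc : c = 0
  · exact ⟨1, by simp, by simp [hc]⟩
  · have : (‖c‖ : ℂ) ≠ 0 := by simpa using hc
    exact ⟨c / ‖c‖, by simp [hc], by field_simp⟩

theorem norm_add_unimodular_mul {c t : ℂ} (ht : ‖t‖ = 1) (hc : c = t * ‖c‖) {s : ℝ}
    (hs : 0 ≤ s) : ‖c + t * s‖ = ‖c‖ + s := by
  have : c + t * s = t * ((‖c‖ + s : ℝ) : ℂ) := by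
    push_cast
    rw [mul_add, ← hc]
  rw [this, norm_mul, ht, one_mul, norm_real, Real.norm_of_nonneg (by positivity)]

/-- Carlson's inequality for coefficients of odd index. -/
theorem carlson_odd {a : ℕ → ℂ} (ha : Summable fun k => ‖a k‖)
    (hb : ∀ z : ℂ, ‖z‖ = 1 → ‖∑' k, a k * z ^ k‖ ≤ 1) (n : ℕ) :
    ‖a (2 * n + 1)‖ ≤ 1 - ∑ m ∈ range (n + 1), ‖a m‖ ^ 2 := by
  obtain ⟨t, ht, hc⟩ := exists_unimodular_mul_norm (a (2 * n + 1))
  have h := toeplitz_reflected_vector ha hb (K := n + 1) (N := 2 * n + 1) (by omega)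
    (fun _ => 1) ht
  have hs : 0 ≤ ∑ m ∈ range (n + 1), ‖a m‖ ^ 2 := sum_nonneg fun _ _ => by positivity
  have e : ∀ i ∈ range (n + 1), ‖a i + ∑ m ∈ range (n + 1), (if 2 * n + 1 - m ≤ i then
      a (i - (2 * n + 1 - m)) * (t * ((1 : ℝ) : ℂ) * conj (a m)) else 0)‖ ^ 2 = ‖a i‖ ^ 2 := by
    intro i hi
    rw [mem_range] at hi
    rw [sum_eq_zero, add_zero]
    intro m hm
    rw [mem_range] at hm
    rw [if_neg (by omega)]
  rw [sum_congr rfl e] at h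
  simp only [one_mul, one_pow] at h
  rw [norm_add_unimodular_mul ht hc hs] at h
  nlinarith [norm_nonneg (a (2 * n + 1))]

/-- Carlson's inequality for coefficients of even positive index. -/
theorem carlson_even {a : ℕ → ℂ} (ha : Summable fun k => ‖a k‖)
    (hb : ∀ z : ℂ, ‖z‖ = 1 → ‖∑' k, a k * z ^ k‖ ≤ 1) {n : ℕ} (hn : 1 ≤ n) :
    ‖a (2 * n)‖ ≤ 1 - ∑ m ∈ range n, ‖a m‖ ^ 2 - ‖a n‖ ^ 2 / (1 + ‖a 0‖) := by
  obtain ⟨t, ht, hc⟩ := exists_unimodular_mul_norm (a (2 * n))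
  set β : ℝ := 1 / (1 + ‖a 0‖) with hβ
  have hβ0 : 0 < β := by positivity
  have hβa : ‖a 0‖ * β = 1 - β := by
    rw [hβ]
    field_simp
    ring
  have h := toeplitz_reflected_vector ha hb (K := n + 1) (N := 2 * n) (by omega)
    (fun m => if m = n then β else 1) ht
  have hs : 0 ≤ ∑ m ∈ range n, ‖a m‖ ^ 2 := sum_nonneg fun _ _ => by positivity
  have hw1 : ∑ m ∈ range (n + 1), (if m = n then β else 1) * ‖a m‖ ^ 2 =
      ∑ m ∈ range n, ‖a m‖ ^ 2 + β * ‖a n‖ ^ 2 := by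
    rw [sum_range_succ, if_pos rfl]
    congr 1
    refine sum_congr rfl fun m hm => ?_
    rw [if_neg (mem_range.mp hm).ne, one_mul]
  have hw2 : ∑ m ∈ range (n + 1), (if m = n then β else 1) ^ 2 * ‖a m‖ ^ 2 =
      ∑ m ∈ range n, ‖a m‖ ^ 2 + β ^ 2 * ‖a n‖ ^ 2 := by
    rw [sum_range_succ, if_pos rfl]
    congr 1
    refine sum_congr rfl fun m hm => ?_
    rw [if_neg (mem_range.mp hm).ne, one_pow, one_mul]
  rw [hw1, hw2, norm_add_unimodular_mul ht hc (by positivity), sum_range_succ] at h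
  have e : ∀ i ∈ range n, ‖a i + ∑ m ∈ range (n + 1), (if 2 * n - m ≤ i then
      a (i - (2 * n - m)) * (t * ((if m = n then β else 1 : ℝ) : ℂ) * conj (a m)) else 0)‖ ^ 2 =
      ‖a i‖ ^ 2 := by
    intro i hi
    rw [mem_range] at hi
    rw [sum_eq_zero, add_zero]
    intro m hm
    rw [mem_range] at hm
    rw [if_neg (by omega)]
  have e' : ∑ m ∈ range (n + 1), (if 2 * n - m ≤ n then
      a (n - (2 * n - m)) * (t * ((if m = n then β else 1 : ℝ) : ℂ) * conj (a m)) else 0) =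
      a 0 * (t * β * conj (a n)) := by
    rw [sum_range_succ, sum_eq_zero, zero_add, if_pos (by omega), if_pos rfl]
    · congr 2
      omega
    · intro m hm
      rw [mem_range] at hm
      rw [if_neg (by omega)]
  rw [sum_congr rfl e, e'] at h
  have hlow : β * ‖a n‖ ≤ ‖a n + a 0 * (t * β * conj (a n))‖ := by
    have h1 := norm_sub_le (a n + a 0 * (t * β * conj (a n))) (a 0 * (t * β * conj (a n)))
    have h2 : ‖a 0 * (t * β * conj (a n))‖ = (1 - β) * ‖a n‖ := by
      rw [norm_mul, norm_mul, norm_mul, ht, RCLike.norm_conj, norm_real,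
        Real.norm_of_nonneg hβ0.le, ← hβa]
      ring
    rw [h2, add_sub_cancel_right] at h1
    linarith
  have hlow2 : β ^ 2 * ‖a n‖ ^ 2 ≤ ‖a n + a 0 * (t * β * conj (a n))‖ ^ 2 := by
    rw [← mul_pow]
    gcongr
  have hd : ‖a n‖ ^ 2 / (1 + ‖a 0‖) = β * ‖a n‖ ^ 2 := by
    rw [hβ]
    ring
  rw [hd]
  have : 0 ≤ β * ‖a n‖ ^ 2 := by positivity
  nlinarith [norm_nonneg (a (2 * n))]

/-- A refined Bohr inequality for sequences satisfying Carlson's inequalities. -/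
theorem bohr_partial_sum_le {b : ℕ → ℝ} (hb0 : ∀ k, 0 ≤ b k)
    (hodd : ∀ n, b (2 * n + 1) ≤ 1 - ∑ m ∈ range (n + 1), b m ^ 2)
    (heven : ∀ n, b (2 * n + 2) ≤ 1 - ∑ m ∈ range (n + 1), b m ^ 2 - b (n + 1) ^ 2 / (1 + b 0))
    {r : ℝ} (hr0 : 0 ≤ r) (hr1 : r < 1) (N : ℕ) :
    ∑ k ∈ range (2 * N), b (k + 1) * r ^ (k + 1) +
      (1 / (1 + b 0) + r / (1 - r)) * ∑ k ∈ range N, (b (k + 1) * r ^ (k + 1)) ^ 2 ≤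
    (1 - b 0 ^ 2) * (r / (1 - r)) := by
  have hr : 0 < 1 - r := by linarith
  have hD : ∀ n, ∑ m ∈ range (n + 1), b m ^ 2 = b 0 ^ 2 + ∑ m ∈ range n, b (m + 1) ^ 2 := by
    intro n
    rw [sum_range_succ', add_comm]
  have key : ∑ k ∈ range (2 * N), b (k + 1) * r ^ (k + 1) +
      (1 / (1 + b 0) + r / (1 - r)) * ∑ k ∈ range N, (b (k + 1) * r ^ (k + 1)) ^ 2 ≤
      (1 - b 0 ^ 2) * (r * (1 - r ^ (2 * N)) / (1 - r)) +
        (∑ m ∈ range N, b (m + 1) ^ 2) * (r ^ (2 * N + 1) / (1 - r)) := by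
    induction N with
    | zero => simp
    | succ N ih =>
      have h1 := mul_le_mul_of_nonneg_right (hodd N) (pow_nonneg hr0 (2 * N + 1))
      have h2 := mul_le_mul_of_nonneg_right (heven N) (pow_nonneg hr0 (2 * N + 2))
      rw [hD] at h1 h2
      rw [show 2 * (N + 1) = 2 * N + 1 + 1 by ring]
      simp only [sum_range_succ]
      set A := ∑ k ∈ range (2 * N), b (k + 1) * r ^ (k + 1)
      set B := ∑ k ∈ range N, (b (k + 1) * r ^ (k + 1)) ^ 2
      set D := ∑ m ∈ range N, b (m + 1) ^ 2
      have e : (1 - b 0 ^ 2) * (r * (1 - r ^ (2 * N + 1 + 1)) / (1 - r)) +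
          (D + b (N + 1) ^ 2) * (r ^ (2 * N + 1 + 1 + 1) / (1 - r)) -
          (1 / (1 + b 0) + r / (1 - r)) * (b (N + 1) * r ^ (N + 1)) ^ 2 =
          (1 - b 0 ^ 2) * (r * (1 - r ^ (2 * N)) / (1 - r)) + D * (r ^ (2 * N + 1) / (1 - r)) +
          (1 - (b 0 ^ 2 + D)) * r ^ (2 * N + 1) +
          (1 - (b 0 ^ 2 + D) - b (N + 1) ^ 2 / (1 + b 0)) * r ^ (2 * N + 2) := by
        have : 1 + b 0 ≠ 0 := by linarith [hb0 0]
        field_simp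
        ring
      rw [mul_add]
      have e3 : 2 * N + 1 + 1 = 2 * N + 2 := rfl
      rw [e3] at *
      linarith
  refine key.trans ?_
  have h1 := (hb0 _).trans (hodd N)
  rw [hD] at h1
  have h2 : (1 - b 0 ^ 2) * (r / (1 - r)) = (1 - b 0 ^ 2) * (r * (1 - r ^ (2 * N)) / (1 - r)) +
      (1 - b 0 ^ 2) * (r ^ (2 * N + 1) / (1 - r)) := by
    field_simp
    ring
  rw [h2]
  gcongr
  linarith

/-- The growth form of the Schwarz–Pick lemma at the origin. -/
theorem norm_le_of_mapsTo_unit_ball {g : ℂ → ℂ} (hg : DifferentiableOn ℂ g (Metric.ball 0 1))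
    (hb : ∀ z ∈ Metric.ball (0 : ℂ) 1, ‖g z‖ < 1) {z : ℂ} (hz : ‖z‖ < 1) :
    ‖g z‖ ≤ (‖z‖ + ‖g 0‖) / (1 + ‖g 0‖ * ‖z‖) := by
  have ha : ‖g 0‖ < 1 := hb 0 (by simp)
  have hne : ∀ u ∈ Metric.ball (0 : ℂ) 1, 1 - conj (g 0) * g u ≠ 0 := by
    intro u hu h
    have h1 : ‖conj (g 0) * g u‖ = 1 := by rw [← sub_eq_zero.mp h, norm_one]
    rw [norm_mul, RCLike.norm_conj] at h1
    nlinarith [hb u hu, norm_nonneg (g u), norm_nonneg (g 0)]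
  have hid : ∀ u v : ℂ, ‖1 - conj u * v‖ ^ 2 - ‖v - u‖ ^ 2 = (1 - ‖u‖ ^ 2) * (1 - ‖v‖ ^ 2) := by
    intro u v
    simp only [← normSq_eq_norm_sq, normSq_apply, sub_re, sub_im, mul_re, mul_im, conj_re, conj_im,
      one_re, one_im]
    ring
  have hz' : z ∈ Metric.ball (0 : ℂ) 1 := by simpa using hz
  have hS := norm_le_norm_of_mapsTo_ball (R := 1)
    (f := fun u => (g u - g 0) / (1 - conj (g 0) * g u))
    ((hg.sub_const _).div ((hg.const_mul _).const_sub _) hne) (by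
      intro u hu
      have h1 := hid (g 0) (g u)
      have h2 : 0 < ‖1 - conj (g 0) * g u‖ := norm_pos_iff.mpr (hne u hu)
      rw [mem_closedBall_zero_iff, norm_div, div_le_one h2]
      refine le_of_sq_le_sq ?_ h2.le
      have h3 : 0 ≤ (1 - ‖g 0‖ ^ 2) * (1 - ‖g u‖ ^ 2) := by
        have := hb u hu
        apply mul_nonneg <;> nlinarith [norm_nonneg (g u), norm_nonneg (g 0)]
      linarith) (by simp) hz
  have h2 : 0 < ‖1 - conj (g 0) * g z‖ := norm_pos_iff.mpr (hne z hz')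
  simp only [norm_div] at hS
  rw [div_le_iff₀ h2] at hS
  have h1 := hid (g 0) (g z)
  have hG := hb z hz'
  have h3 : 1 - ‖g 0‖ * ‖g z‖ ≤ ‖1 - conj (g 0) * g z‖ := by
    have := norm_sub_norm_le (1 : ℂ) (conj (g 0) * g z)
    rwa [norm_one, norm_mul, RCLike.norm_conj] at this
  have h4 : 0 ≤ 1 - ‖g 0‖ * ‖g z‖ := by nlinarith [norm_nonneg (g z), norm_nonneg (g 0)]
  have hS2 : ‖g z - g 0‖ ^ 2 ≤ ‖z‖ ^ 2 * ‖1 - conj (g 0) * g z‖ ^ 2 := by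
    rw [← mul_pow]
    gcongr
  have h5 : (1 - ‖g 0‖ * ‖g z‖) ^ 2 ≤ ‖1 - conj (g 0) * g z‖ ^ 2 := by gcongr
  have h6 : (‖g z‖ - ‖g 0‖) ^ 2 ≤ (‖z‖ * (1 - ‖g 0‖ * ‖g z‖)) ^ 2 := by
    have : 0 ≤ 1 - ‖z‖ ^ 2 := by nlinarith [norm_nonneg z]
    nlinarith [mul_le_mul_of_nonneg_left h5 this]
  have h7 := le_of_sq_le_sq h6 (by positivity)
  rw [le_div_iff₀ (by positivity)]
  linarith


/-- Multidimensional version of Theorem C (Theorem 5 of Liu–Ponnusamy):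
if `Q ⊆ ℂⁿ` is an open complete circular domain containing `0`, `f` holomorphic on `Q`
with `|f| < 1`, expanded as `f = Σ_k P_k` with `P_k` homogeneous of degree `k`,
`a = |f(0)| < 1`, `p > 0`, and `A_{a,p}(r) = [1-(2-a²)r](1+ar)^p - (1-r)(r+a)^p ≥ 0`
for `r ∈ [0,1)`, then
`|f(r•w)|^p + Σ_{k≥1} |P_k(r•w)| + (1/(1+a) + r/(1-r)) Σ_{k≥1} |P_k(r•w)|² ≤ 1`. -/
theorem stmt_6 (n : ℕ) (Q : Set (Fin n → ℂ)) (hQopen : IsOpen Q)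
    (h0Q : (0 : Fin n → ℂ) ∈ Q)
    (hcirc : ∀ z ∈ Q, ∀ ξ : ℂ, ‖ξ‖ ≤ 1 → ξ • z ∈ Q)
    (f : (Fin n → ℂ) → ℂ) (hf : DifferentiableOn ℂ f Q)
    (hb : ∀ z ∈ Q, ‖f z‖ < 1)
    (P : ℕ → (Fin n → ℂ) → ℂ)
    (hhom : ∀ (k : ℕ) (ξ : ℂ) (z : Fin n → ℂ), P k (ξ • z) = ξ ^ k * P k z)
    (hP0 : ∀ z : Fin n → ℂ, P 0 z = f 0)
    (hsum : ∀ z ∈ Q, HasSum (fun k : ℕ => P k z) (f z))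
    (ha : ‖f 0‖ < 1) (p : ℝ) (hp0 : 0 < p)
    (w : Fin n → ℂ) (hw : w ∈ Q) (r : ℝ) (hr0 : 0 ≤ r) (hr1 : r < 1)
    (hA : 0 ≤ (1 - (2 - ‖f 0‖ ^ 2) * r) * (1 + ‖f 0‖ * r) ^ p
            - (1 - r) * (r + ‖f 0‖) ^ p) :
    Summable (fun k : ℕ => ‖P (k + 1) ((r : ℂ) • w)‖) ∧
    Summable (fun k : ℕ => ‖P (k + 1) ((r : ℂ) • w)‖ ^ 2) ∧
    ‖f ((r : ℂ) • w)‖ ^ p + (∑' k : ℕ, ‖P (k + 1) ((r : ℂ) • w)‖) +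
      (1 / (1 + ‖f 0‖) + r / (1 - r)) *
        ∑' k : ℕ, ‖P (k + 1) ((r : ℂ) • w)‖ ^ 2 ≤ 1 := by
  let a : ℕ → ℂ := fun k => P k w
  have hslice : ∀ ξ : ℂ, ‖ξ‖ ≤ 1 → HasSum (fun k => a k * ξ ^ k) (f (ξ • w)) := by
    intro ξ hξ
    refine (hsum _ (hcirc w hw ξ hξ)).congr_fun fun k => ?_
    rw [hhom, mul_comm]
  have hnorm : Summable fun k => ‖a k‖ := (hsum w hw).summable.norm
  have hbd : ∀ z : ℂ, ‖z‖ = 1 → ‖∑' k, a k * z ^ k‖ ≤ 1 := by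
    intro z hz
    rw [(hslice z hz.le).tsum_eq]
    exact (hb _ (hcirc w hw z hz.le)).le
  have ha0 : ‖a 0‖ = ‖f 0‖ := congrArg norm (hP0 w)
  have hPr : ∀ k, ‖P k ((r : ℂ) • w)‖ = ‖a k‖ * r ^ k := by
    intro k
    rw [hhom, norm_mul, norm_pow, norm_real, Real.norm_of_nonneg hr0, mul_comm]
  simp only [hPr]
  have hs1 : Summable fun k => ‖a (k + 1)‖ * r ^ (k + 1) := by
    refine Summable.of_nonneg_of_le (fun k => by positivity) (fun k => ?_)
      ((summable_nat_add_iff 1).mpr hnorm)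
    exact mul_le_of_le_one_right (norm_nonneg _) (pow_le_one₀ hr0 hr1.le)
  have hs2 : Summable fun k => (‖a (k + 1)‖ * r ^ (k + 1)) ^ 2 := by
    refine Summable.of_nonneg_of_le (fun k => by positivity) (fun k => ?_) (hs1.mul_left
      (∑' k, ‖a (k + 1)‖ * r ^ (k + 1)))
    rw [sq]
    gcongr
    exact hs1.le_tsum k fun j _ => by positivity
  refine ⟨hs1, hs2, ?_⟩
  have hbohr : ∑' k, ‖a (k + 1)‖ * r ^ (k + 1) +
      (1 / (1 + ‖f 0‖) + r / (1 - r)) * ∑' k, (‖a (k + 1)‖ * r ^ (k + 1)) ^ 2 ≤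
      (1 - ‖f 0‖ ^ 2) * (r / (1 - r)) := by
    have hlim := (hs1.hasSum.tendsto_sum_nat.comp
      (Filter.tendsto_id.const_mul_atTop' (two_pos : 0 < (2 : ℕ)))).add
      (hs2.hasSum.tendsto_sum_nat.const_mul (1 / (1 + ‖f 0‖) + r / (1 - r)))
    refine le_of_tendsto' hlim fun N => ?_
    have h := bohr_partial_sum_le (b := fun k => ‖a k‖) (fun _ => norm_nonneg _)
      (carlson_odd hnorm hbd) (fun n => carlson_even hnorm hbd (Nat.succ_pos n)) hr0 hr1 N
    simp only [ha0] at h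
    exact h
  have hgrowth : ‖f ((r : ℂ) • w)‖ ≤ (r + ‖f 0‖) / (1 + ‖f 0‖ * r) := by
    have hmem : ∀ ξ ∈ Metric.ball (0 : ℂ) 1, ξ • w ∈ Q := fun ξ hξ =>
      hcirc w hw ξ (mem_ball_zero_iff.mp hξ).le
    have h := norm_le_of_mapsTo_unit_ball (g := fun ξ : ℂ => f (ξ • w))
      (hf.comp (differentiable_id.smul_const w).differentiableOn hmem)
      (fun ξ hξ => hb _ (hmem ξ hξ)) (z := (r : ℂ))
      (by rwa [norm_real, Real.norm_of_nonneg hr0])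
    simpa only [zero_smul, norm_real, Real.norm_of_nonneg hr0] using h
  have hpow : ‖f ((r : ℂ) • w)‖ ^ p ≤ (r + ‖f 0‖) ^ p / (1 + ‖f 0‖ * r) ^ p := by
    rw [← Real.div_rpow (by positivity) (by positivity)]
    exact Real.rpow_le_rpow (norm_nonneg _) hgrowth hp0.le
  have hfin : (r + ‖f 0‖) ^ p / (1 + ‖f 0‖ * r) ^ p + (1 - ‖f 0‖ ^ 2) * (r / (1 - r)) ≤ 1 := by
    have hr : 0 < 1 - r := by linarith
    have hd : 0 < (1 + ‖f 0‖ * r) ^ p := Real.rpow_pos_of_pos (by positivity) p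
    rw [mul_div_assoc', div_add_div _ _ hd.ne' hr.ne', div_le_one (by positivity)]
    linarith
  linarith
end

section
/- Let f be analytic on the open unit disk 𝔻 ⊂ ℂ with |f(z)| ≤ 1 for all z ∈ 𝔻, and write f(z) = Σ_{n=0}^∞ a_n z^n. Let p ∈ (0,2] and N ≥ 1 be an integer. Then for every z ∈ 𝔻 with |z| = r, where r ∈ [0,1) satisfies 2(1+r)r^N ≤ p(1−r)² (equivalently r ≤ R_{N,p}, the positive root of 2(1+r)r^N − p(1−r)² = 0), one has |f(z)|^p + Σ_{n=N}^∞ |a_n| r^n ≤ 1. -/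
open Metric Filter Topology Asymptotics
open scoped ComplexConjugate

/-- The identity behind the Schwarz–Pick inequality. -/
lemma norm_one_sub_conj_mul_sq_sub (a w : ℂ) :
    ‖1 - conj a * w‖ ^ 2 - ‖w - a‖ ^ 2 = (1 - ‖a‖ ^ 2) * (1 - ‖w‖ ^ 2) := by
  simp only [Complex.sq_norm, Complex.normSq_apply, Complex.sub_re, Complex.sub_im,
    Complex.mul_re, Complex.mul_im, Complex.conj_re, Complex.conj_im, Complex.one_re,
    Complex.one_im]
  ring

/-- Schwarz–Pick inequality at the origin for functions `h` with `h z - h 0 = o(z ^ n)`. -/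
lemma norm_sub_le_pow_mul_of_isLittleO {h : ℂ → ℂ} {n : ℕ}
    (hd : DifferentiableOn ℂ h (ball 0 1)) (hb : ∀ z ∈ ball (0 : ℂ) 1, ‖h z‖ ≤ 1)
    (hn : (fun z ↦ h z - h 0) =o[𝓝 0] (fun z ↦ ‖z‖ ^ n)) {z : ℂ} (hz : z ∈ ball (0 : ℂ) 1) :
    ‖h z - h 0‖ ≤ ‖z‖ ^ (n + 1) * ‖1 - conj (h 0) * h z‖ := by
  have h0 : (0 : ℂ) ∈ ball (0 : ℂ) 1 := mem_ball_self one_pos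
  rcases (hb 0 h0).eq_or_lt with h1 | h1
  · have hmax : IsMaxOn (norm ∘ h) (ball 0 1) 0 := fun w hw ↦ by
      simpa [h1] using hb w hw
    have := Complex.eqOn_of_isPreconnected_of_isMaxOn_norm
      (convex_ball (0 : ℂ) 1).isPreconnected isOpen_ball hd h0 hmax hz
    simp only [Function.const_apply] at this
    rw [this, sub_self, norm_zero]
    positivity
  have hden : ∀ w ∈ ball (0 : ℂ) 1, 1 - conj (h 0) * h w ≠ 0 := fun w hw hw0 ↦ by
    have h2 : ‖conj (h 0) * h w‖ = 1 := by rw [← sub_eq_zero.mp hw0, norm_one]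
    rw [norm_mul, RCLike.norm_conj] at h2
    nlinarith [hb w hw, norm_nonneg (h 0), norm_nonneg (h w)]
  set φ : ℂ → ℂ := fun w ↦ (h w - h 0) / (1 - conj (h 0) * h w) with hφ
  have hφ0 : φ 0 = 0 := by simp [hφ]
  have hφd : DifferentiableOn ℂ φ (ball 0 1) :=
    (hd.sub_const _).div ((differentiableOn_const _).sub (hd.const_mul _)) hden
  have hmaps : Set.MapsTo φ (ball 0 1) (closedBall (φ 0) 1) := fun w hw ↦ by
    rw [hφ0, mem_closedBall_zero_iff, hφ, norm_div]
    refine div_le_one_of_le₀ (abs_le_of_sq_le_sq' ?_ (norm_nonneg _)).2 (norm_nonneg _)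
    have := norm_one_sub_conj_mul_sq_sub (h 0) (h w)
    have h3 := hb w hw
    have : 0 ≤ (1 - ‖h 0‖ ^ 2) * (1 - ‖h w‖ ^ 2) := by
      apply mul_nonneg <;> nlinarith [norm_nonneg (h 0), norm_nonneg (h w)]
    linarith
  have hcont : ContinuousAt h 0 := hd.continuousOn.continuousAt (ball_mem_nhds _ one_pos)
  have hφo : (φ · - φ 0) =o[𝓝 0] (fun w ↦ ‖w - 0‖ ^ n) := by
    have hinv : ContinuousAt (fun w ↦ (1 - conj (h 0) * h w)⁻¹) 0 :=
      (continuousAt_const.sub (continuousAt_const.mul hcont)).inv₀ (hden 0 h0)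
    simpa [hφ, div_eq_mul_inv] using hn.mul_isBigO (hinv.tendsto.isBigO_one ℝ)
  have key := Complex.dist_le_mul_div_pow_of_mapsTo_ball_of_isLittleO hφd hmaps hφo hz
  rw [hφ0, dist_zero_right, dist_zero_right, hφ, norm_div, one_mul, div_one,
    div_le_iff₀ (norm_pos_iff.2 (hden z hz))] at key
  exact key

/-- If `h = d 0 + d n * z ^ n + ⋯` is bounded by one on the disk, then `‖d n‖ ≤ 1 - ‖d 0‖ ^ 2`. -/
lemma norm_coeff_le_of_gap {h : ℂ → ℂ} {d : ℕ → ℂ} {n : ℕ}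
    (hd : DifferentiableOn ℂ h (ball 0 1)) (hb : ∀ z ∈ ball (0 : ℂ) 1, ‖h z‖ ≤ 1)
    (hsum : ∀ z ∈ ball (0 : ℂ) 1, HasSum (fun m ↦ d m * z ^ m) (h z))
    (hgap : ∀ m, 0 < m → m < n + 1 → d m = 0) :
    ‖d (n + 1)‖ ≤ 1 - ‖d 0‖ ^ 2 := by
  have h0 : (0 : ℂ) ∈ ball (0 : ℂ) 1 := mem_ball_self one_pos
  have hh0 : h 0 = d 0 := (hsum 0 h0).unique (by
    simpa using hasSum_single (f := fun m ↦ d m * (0 : ℂ) ^ m) 0 (fun m hm ↦ by simp [hm]))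
  set q : ℂ → ℂ := fun z ↦ ∑' m, d (m + (n + 1)) * z ^ m with hq
  have hsummable : Summable fun m ↦ ‖d (m + (n + 1))‖ * (1 / 2 : ℝ) ^ m := by
    have h1 := (hsum (1 / 2) (by norm_num [mem_ball_zero_iff])).summable.norm
    have h2 := ((summable_nat_add_iff (n + 1)).2 h1).mul_right ((2 : ℝ) ^ (n + 1))
    refine h2.congr fun m ↦ ?_
    simp only [norm_mul, norm_pow, norm_div, norm_one, Complex.norm_ofNat, pow_add _ m]
    rw [mul_assoc, mul_assoc, ← mul_pow]
    norm_num
  have hqlim : Tendsto q (𝓝 0) (𝓝 (d (n + 1))) := by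
    have h1 : ∑' m, d (m + (n + 1)) * (0 : ℂ) ^ m = d (n + 1) := by
      rw [tsum_eq_single 0 (fun m hm ↦ by simp [hm])]
      simp
    rw [← h1]
    refine tendsto_tsum_of_dominated_convergence hsummable (fun m ↦ ?_) ?_
    · exact Continuous.tendsto (by fun_prop) 0
    · filter_upwards [ball_mem_nhds (0 : ℂ) (by norm_num : (0 : ℝ) < 1 / 2)] with z hz m
      rw [norm_mul, norm_pow]
      gcongr
      exact (mem_ball_zero_iff.1 hz).le
  have hdecomp : ∀ z ∈ ball (0 : ℂ) 1, h z - h 0 = z ^ (n + 1) * q z := fun z hz ↦ by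
    have h1 := (hsum z hz).summable.sum_add_tsum_nat_add (n + 1)
    rw [(hsum z hz).tsum_eq, Finset.sum_eq_single_of_mem 0 (by simp) (fun m hm hm0 ↦ by
      rw [hgap m (Nat.pos_of_ne_zero hm0) (Finset.mem_range.1 hm), zero_mul])] at h1
    rw [← h1, hh0, hq, ← tsum_mul_left]
    simp only [pow_zero, mul_one, add_sub_cancel_left]
    exact tsum_congr fun m ↦ by ring
  have hball := ball_mem_nhds (0 : ℂ) one_pos
  have ho : (fun z ↦ h z - h 0) =o[𝓝 0] (fun z ↦ ‖z‖ ^ n) := by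
    have h1 : (fun z : ℂ ↦ z ^ (n + 1)) =o[𝓝 0] (fun z ↦ ‖z‖ ^ n) := by
      refine IsLittleO.of_norm_right ?_
      simpa using (isLittleO_pow_pow (𝕜 := ℂ) n.lt_succ_self).norm_right
    refine ((h1.mul_isBigO (hqlim.isBigO_one ℝ)).congr' ?_ (by simp))
    filter_upwards [hball] with z hz using (hdecomp z hz).symm
  have hcont : ContinuousAt h 0 := hd.continuousOn.continuousAt hball
  have hlim : Tendsto (fun z ↦ ‖1 - conj (h 0) * h z‖) (𝓝[≠] 0) (𝓝 (1 - ‖d 0‖ ^ 2)) := by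
    have h1 : ‖1 - conj (h 0) * h 0‖ = 1 - ‖d 0‖ ^ 2 := by
      have h2 : 0 ≤ 1 - ‖h 0‖ ^ 2 := by nlinarith [hb 0 h0, norm_nonneg (h 0)]
      rw [Complex.conj_mul', ← hh0, ← abs_of_nonneg h2, ← Real.norm_eq_abs, ← Complex.norm_real]
      simp
    rw [← h1]
    exact ((continuousAt_const.sub (continuousAt_const.mul hcont)).norm.tendsto).mono_left
      nhdsWithin_le_nhds
  refine le_of_tendsto_of_tendsto (hqlim.norm.mono_left nhdsWithin_le_nhds) hlim ?_
  filter_upwards [self_mem_nhdsWithin, nhdsWithin_le_nhds hball] with z hz0 hz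
  have h1 := norm_sub_le_pow_mul_of_isLittleO hd hb ho hz
  rw [hdecomp z hz, norm_mul, norm_pow] at h1
  exact le_of_mul_le_mul_left h1 (pow_pos (norm_pos_iff.2 hz0) _)

/-- Wiener's coefficient inequality for analytic self-maps of the closed disk. -/
lemma norm_coeff_le_one_sub_sq {f : ℂ → ℂ} {c : ℕ → ℂ}
    (hf : DifferentiableOn ℂ f (ball 0 1)) (hb : ∀ z ∈ ball (0 : ℂ) 1, ‖f z‖ ≤ 1)
    (hsum : ∀ z ∈ ball (0 : ℂ) 1, HasSum (fun m ↦ c m * z ^ m) (f z)) {n : ℕ} (hn : 0 < n) :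
    ‖c n‖ ≤ 1 - ‖c 0‖ ^ 2 := by
  obtain ⟨k, rfl⟩ := Nat.exists_eq_succ_of_ne_zero hn.ne'
  have hζ := Complex.isPrimitiveRoot_exp (k + 1) k.succ_ne_zero
  set ζ := Complex.exp (2 * Real.pi * Complex.I / (k + 1 : ℕ))
  have hk : ((k + 1 : ℕ) : ℂ) ≠ 0 := Nat.cast_ne_zero.2 k.succ_ne_zero
  have hζn : ‖ζ‖ = 1 := hζ.norm'_eq_one k.succ_ne_zero
  have hrot : ∀ j : ℕ, ∀ z ∈ ball (0 : ℂ) 1, ζ ^ j * z ∈ ball (0 : ℂ) 1 := fun j z hz ↦ by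
    simpa [hζn] using hz
  set s : ℕ → ℂ := fun m ↦ ((k + 1 : ℕ) : ℂ)⁻¹ * ∑ j ∈ Finset.range (k + 1), (ζ ^ j) ^ m with hs
  have hs0 : s 0 = 1 := by
    simp only [hs, pow_zero, Finset.sum_const, Finset.card_range, nsmul_eq_mul, mul_one]
    exact inv_mul_cancel₀ hk
  have hsk : s (k + 1) = 1 := by
    rw [← hs0]
    simp only [hs, pow_right_comm ζ _ (k + 1), hζ.pow_eq_one, one_pow, pow_zero]
  have key := norm_coeff_le_of_gap (n := k) (d := fun m ↦ c m * s m)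
    (h := fun z ↦ ((k + 1 : ℕ) : ℂ)⁻¹ * ∑ j ∈ Finset.range (k + 1), f (ζ ^ j * z)) ?_ ?_ ?_ ?_
  · simpa [hs0, hsk] using key
  · refine DifferentiableOn.const_mul (DifferentiableOn.fun_sum fun j _ ↦ ?_) _
    exact hf.comp (differentiableOn_id.const_mul _) (hrot j)
  · intro z hz
    rw [norm_mul, norm_inv, Complex.norm_natCast, inv_mul_le_iff₀ (by positivity), mul_one]
    refine (norm_sum_le_of_le _ fun j _ ↦ hb _ (hrot j z hz)).trans ?_
    simp
  · intro z hz
    refine ((hasSum_sum fun j _ ↦ hsum _ (hrot j z hz)).mul_left _).congr_fun ?_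
    intro m
    simp only [hs, Finset.mul_sum, Finset.sum_mul]
    exact Finset.sum_congr rfl fun j _ ↦ by ring
  · intro m hm0 hmk
    have h1 : ζ ^ m ≠ 1 := fun h1 ↦ Nat.not_le.2 hmk (Nat.le_of_dvd hm0 (hζ.dvd_of_pow_eq_one m h1))
    have h2 : ∑ j ∈ Finset.range (k + 1), (ζ ^ j) ^ m = 0 := by
      simp only [pow_right_comm ζ _ m]
      rw [geom_sum_eq h1, ← pow_mul, mul_comm, pow_mul, hζ.pow_eq_one, one_pow, sub_self, zero_div]
    simp [hs, h2]

/-- Growth estimate: `1 - ‖f z‖ ^ 2` decays at most like `(1 - r) / (1 + r)`. -/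
lemma one_sub_sq_mul_le {f : ℂ → ℂ} (hf : DifferentiableOn ℂ f (ball 0 1))
    (hb : ∀ z ∈ ball (0 : ℂ) 1, ‖f z‖ ≤ 1) {z : ℂ} (hz : z ∈ ball (0 : ℂ) 1) :
    (1 - ‖f 0‖ ^ 2) * (1 - ‖z‖) ≤ (1 - ‖f z‖ ^ 2) * (1 + ‖z‖) := by
  have h0 : (0 : ℂ) ∈ ball (0 : ℂ) 1 := mem_ball_self one_pos
  have ho : (fun w ↦ f w - f 0) =o[𝓝 0] (fun w : ℂ ↦ ‖w‖ ^ 0) := by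
    simpa using (hf.continuousOn.continuousAt (ball_mem_nhds _ one_pos)).tendsto.sub_const (f 0)
  have hsp := norm_sub_le_pow_mul_of_isLittleO hf hb ho hz
  have hid := norm_one_sub_conj_mul_sq_sub (f 0) (f z)
  have htri : 1 - ‖f 0‖ * ‖f z‖ ≤ ‖1 - conj (f 0) * f z‖ := by
    simpa using norm_sub_norm_le 1 (conj (f 0) * f z)
  have ha1 := hb 0 h0
  have hs1 := hb z hz
  have hr1 : ‖z‖ < 1 := mem_ball_zero_iff.1 hz
  have ha := norm_nonneg (f 0)
  have hs := norm_nonneg (f z)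
  have hr := norm_nonneg z
  have hX := norm_nonneg (f z - f 0)
  generalize ‖1 - conj (f 0) * f z‖ = Y at *
  generalize ‖f z - f 0‖ = X at *
  generalize ‖f 0‖ = a at *
  generalize ‖f z‖ = s at *
  generalize ‖z‖ = r at *
  have has : 0 ≤ 1 - a * s := by nlinarith
  have hsq : X ^ 2 ≤ r ^ 2 * Y ^ 2 := by
    rw [← mul_pow]; exact pow_le_pow_left₀ hX (by simpa using hsp) 2
  have hY : (1 - a * s) ^ 2 ≤ Y ^ 2 := pow_le_pow_left₀ has htri 2
  have h1 : (s - a) ^ 2 ≤ (r * (1 - a * s)) ^ 2 := by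
    have : (1 - r ^ 2) * (1 - a * s) ^ 2 ≤ (1 - r ^ 2) * Y ^ 2 :=
      mul_le_mul_of_nonneg_left hY (by nlinarith)
    nlinarith
  have h2 : s * (1 + a * r) ≤ a + r := by
    have := (abs_le_of_sq_le_sq' h1 (by positivity)).2
    linarith
  have h3 : (s * (1 + a * r)) ^ 2 ≤ (a + r) ^ 2 := pow_le_pow_left₀ (by positivity) h2 2
  have h4 : (1 - s ^ 2) * (1 + a * r) ^ 2 ≤ (1 - s ^ 2) * (1 + r) ^ 2 := by
    have : a * r ≤ r := by nlinarith
    refine mul_le_mul_of_nonneg_left ?_ (by nlinarith)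
    gcongr
  refine le_of_mul_le_mul_right (a := 1 + r) ?_ (by positivity)
  nlinarith


/-- Lemma 1 of Liu–Ponnusamy (extending Theorem B to all `p ∈ (0,2]`): if `f` is
analytic on the unit disk with `|f| ≤ 1` and Taylor expansion `f(z) = Σ aₙ zⁿ`,
`p ∈ (0,2]`, `N ≥ 1`, then for `|z| = r` with `r ∈ [0,1)` and `2(1+r)r^N ≤ p(1-r)²`,
one has `|f(z)|^p + Σ_{n≥N} |aₙ| rⁿ ≤ 1`. -/
theorem stmt_10 (f : ℂ → ℂ) (c : ℕ → ℂ)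
    (hf : DifferentiableOn ℂ f (Metric.ball (0 : ℂ) 1))
    (hsum : ∀ z ∈ Metric.ball (0 : ℂ) 1, HasSum (fun n : ℕ => c n * z ^ n) (f z))
    (hb : ∀ z ∈ Metric.ball (0 : ℂ) 1, ‖f z‖ ≤ 1)
    (p : ℝ) (hp0 : 0 < p) (hp2 : p ≤ 2) (N : ℕ) (hN : 1 ≤ N)
    (r : ℝ) (hr0 : 0 ≤ r) (hr1 : r < 1)
    (hcond : 2 * (1 + r) * r ^ N ≤ p * (1 - r) ^ 2)
    (z : ℂ) (hz : ‖z‖ = r) :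
    Summable (fun n : ℕ => ‖c (n + N)‖ * r ^ (n + N)) ∧
    ‖f z‖ ^ p + ∑' n : ℕ, ‖c (n + N)‖ * r ^ (n + N) ≤ 1 := by
  have hzb : z ∈ ball (0 : ℂ) 1 := by rw [mem_ball_zero_iff, hz]; exact hr1
  have h0 : (0 : ℂ) ∈ ball (0 : ℂ) 1 := mem_ball_self one_pos
  have hf0 : f 0 = c 0 := (hsum 0 h0).unique (by
    simpa using hasSum_single (f := fun m ↦ c m * (0 : ℂ) ^ m) 0 (fun m hm ↦ by simp [hm]))
  have hgrow := one_sub_sq_mul_le hf hb hzb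
  rw [hf0, hz] at hgrow
  have hA : 0 ≤ 1 - ‖c 0‖ ^ 2 := (norm_nonneg _).trans (norm_coeff_le_one_sub_sq hf hb hsum hN)
  have hgeom : HasSum (fun n : ℕ ↦ (1 - ‖c 0‖ ^ 2) * r ^ (n + N))
      ((1 - ‖c 0‖ ^ 2) * ((1 - r)⁻¹ * r ^ N)) := by
    simpa only [pow_add] using
      ((hasSum_geometric_of_lt_one hr0 hr1).mul_right (r ^ N)).mul_left (1 - ‖c 0‖ ^ 2)
  have hle : ∀ n : ℕ, ‖c (n + N)‖ * r ^ (n + N) ≤ (1 - ‖c 0‖ ^ 2) * r ^ (n + N) := fun n ↦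
    mul_le_mul_of_nonneg_right (norm_coeff_le_one_sub_sq hf hb hsum (by omega)) (by positivity)
  have hS : Summable (fun n : ℕ ↦ ‖c (n + N)‖ * r ^ (n + N)) :=
    hgeom.summable.of_nonneg_of_le (fun n ↦ by positivity) hle
  refine ⟨hS, ?_⟩
  have htail := (hS.tsum_le_tsum hle hgeom.summable).trans_eq hgeom.tsum_eq
  have hpow : ‖f z‖ ^ p ≤ 1 + p / 2 * (‖f z‖ ^ 2 - 1) := by
    have h1 := rpow_one_add_le_one_add_mul_self (s := ‖f z‖ ^ 2 - 1) (p := p / 2)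
      (by nlinarith [sq_nonneg ‖f z‖]) (by linarith) (by linarith)
    rwa [add_sub_cancel, ← Real.rpow_natCast, ← Real.rpow_mul (norm_nonneg _),
      Nat.cast_ofNat, mul_div_cancel₀ p two_ne_zero, Real.rpow_ofNat] at h1
  have hr : 0 < 1 - r := sub_pos.2 hr1
  have htail' : (1 - ‖c 0‖ ^ 2) * ((1 - r)⁻¹ * r ^ N) ≤ p / 2 * (1 - ‖f z‖ ^ 2) := by
    have h1 : (1 - r)⁻¹ * r ^ N ≤ p / 2 * ((1 - r) / (1 + r)) := by
      rw [inv_mul_le_iff₀ hr, ← sub_nonneg]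
      have : (1 - r) * (p / 2 * ((1 - r) / (1 + r))) - r ^ N
          = (p * (1 - r) ^ 2 - 2 * (1 + r) * r ^ N) / (2 * (1 + r)) := by
        field_simp
      rw [this]
      exact div_nonneg (by linarith) (by positivity)
    have h2 : (1 - ‖c 0‖ ^ 2) * ((1 - r) / (1 + r)) ≤ 1 - ‖f z‖ ^ 2 := by
      rw [← mul_div_assoc, div_le_iff₀ (by positivity)]
      exact hgrow
    calc _ ≤ (1 - ‖c 0‖ ^ 2) * (p / 2 * ((1 - r) / (1 + r))) := by gcongr
      _ = p / 2 * ((1 - ‖c 0‖ ^ 2) * ((1 - r) / (1 + r))) := by ring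
      _ ≤ _ := by gcongr
  linarith
end

section
/- Let f(z) = Σ_α c_α z^α be holomorphic on the unit polydisk 𝔻ⁿ with f(0) = 0 and |f(z)| < 1 on 𝔻ⁿ. Then for every r ∈ [0,1) with n r² < 1 and every z ∈ ℂⁿ with |z_j| ≤ r for all j, one has Σ_{α ≠ 0} |c_α| |z^α| ≤ √( n r² / (1 − n r²) ). -/
open MeasureTheory Filter Topology

section OrthonormalExpansion

variable {ι X : Type*} [TopologicalSpace X] [CompactSpace X] [MeasurableSpace X] [BorelSpace X]

/-- Bessel's inequality for a uniformly convergent expansion in orthonormal continuous functions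
on a compact probability space. -/
theorem sum_sq_norm_coeff_le_sq_norm (μ : Measure X) [IsProbabilityMeasure μ] {e : ι → C(X, ℂ)}
    (he : Orthonormal ℂ fun i => ContinuousMap.toLp (E := ℂ) 2 μ ℂ (e i))
    {a : ι → ℂ} {G : C(X, ℂ)} (h : HasSum (fun i => a i • e i) G) (s : Finset ι) :
    ∑ i ∈ s, ‖a i‖ ^ 2 ≤ ‖G‖ ^ 2 := by
  classical
  set T := ContinuousMap.toLp (E := ℂ) 2 μ ℂ
  have hsum : HasSum (fun i => a i • T (e i)) (T G) := by
    simpa only [map_smul] using T.hasSum h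
  have hcoeff : ∀ i, inner ℂ (T (e i)) (T G) = a i := fun i => by
    have h₁ := (innerSL ℂ (T (e i))).hasSum hsum
    have h₂ : HasSum (fun j => (innerSL ℂ (T (e i))) (a j • T (e j))) (a i) := by
      convert hasSum_ite_eq i (a i) using 2 with j
      rw [innerSL_apply_apply, inner_smul_right, orthonormal_iff_ite.mp he i j]
      by_cases hj : j = i
      · simp [hj]
      · simp [hj, Ne.symm hj]
    exact h₁.unique h₂
  have hnorm : ‖T G‖ ≤ ‖G‖ := by
    refine (T.le_opNorm G).trans (mul_le_of_le_one_left (norm_nonneg _) ?_)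
    simpa [measureUnivNNReal] using ContinuousMap.toLp_norm_le (E := ℂ) (p := 2) (𝕜 := ℂ) μ
  calc ∑ i ∈ s, ‖a i‖ ^ 2 = ∑ i ∈ s, ‖inner ℂ (T (e i)) (T G)‖ ^ 2 := by simp only [hcoeff]
    _ ≤ ‖T G‖ ^ 2 := he.sum_inner_products_le (T G)
    _ ≤ ‖G‖ ^ 2 := by gcongr

end OrthonormalExpansion

section Polydisk

variable {d : Type*} [Fintype d]

section Torus

noncomputable local instance inst_s17 : MeasureSpace UnitAddCircle := ⟨AddCircle.haarAddCircle⟩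

local instance inst_s17_2 : IsProbabilityMeasure (volume : Measure UnitAddCircle) :=
  inferInstanceAs (IsProbabilityMeasure AddCircle.haarAddCircle)

/-- If a power series is bounded by `M` on the torus of radius `ρ` and converges absolutely there,
then the square sum of its coefficients, weighted by `ρ ^ (2 * |α|)`, is at most `M ^ 2`. -/
theorem sum_sq_norm_coeff_mul_pow_le {f : (d → ℂ) → ℂ} {c : (d → ℕ) → ℂ} {ρ M : ℝ} (hρ : 0 ≤ ρ)
    (hsum : ∀ z : d → ℂ, (∀ i, ‖z i‖ = ρ) → HasSum (fun α : d → ℕ => c α * ∏ i, z i ^ α i) (f z))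
    (hM : 0 ≤ M) (hb : ∀ z : d → ℂ, (∀ i, ‖z i‖ = ρ) → ‖f z‖ ≤ M) (s : Finset (d → ℕ)) :
    ∑ α ∈ s, ‖c α * ∏ i, (ρ : ℂ) ^ α i‖ ^ 2 ≤ M ^ 2 := by
  set a : (d → ℕ) → ℂ := fun α => c α * ∏ i, (ρ : ℂ) ^ α i
  set e : (d → ℕ) → C(UnitAddTorus d, ℂ) := fun α => UnitAddTorus.mFourier fun i => (α i : ℤ)
  have he : Orthonormal ℂ fun α => ContinuousMap.toLp (E := ℂ) 2 volume ℂ (e α) :=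
    UnitAddTorus.orthonormal_mFourier.comp (fun (α : d → ℕ) i => (α i : ℤ)) fun α β h =>
      funext fun i => by simpa using congrFun h i
  have hsummable : Summable fun α => a α • e α := by
    refine Summable.of_norm ?_
    have := (hsum (fun _ => (ρ : ℂ)) fun _ => by simp [abs_of_nonneg hρ]).summable.norm
    simpa only [norm_smul, e, UnitAddTorus.mFourier_norm, mul_one] using this
  have hG : ‖∑' α, a α • e α‖ ≤ M := by
    refine (ContinuousMap.norm_le _ hM).mpr fun t => ?_
    set w : d → ℂ := fun i => ρ * (AddCircle.toCircle (t i) : ℂ)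
    have hw : ∀ i, ‖w i‖ = ρ := fun i => by
      rw [norm_mul, Circle.norm_coe, mul_one, Complex.norm_of_nonneg hρ]
    have h₁ : HasSum (fun α => (a α • e α) t) ((∑' α, a α • e α) t) :=
      ContinuousMap.hasSum_apply hsummable.hasSum t
    have h₂ : (fun α => (a α • e α) t) = fun α => c α * ∏ i, w i ^ α i := by
      funext α
      simp [a, e, w, UnitAddTorus.mFourier, mul_pow, Finset.prod_mul_distrib, mul_assoc,
        fourier_apply, AddCircle.toCircle_nsmul]
    rw [h₂] at h₁
    rw [h₁.unique (hsum w hw)]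
    exact hb w hw
  calc ∑ α ∈ s, ‖a α‖ ^ 2 ≤ ‖∑' α, a α • e α‖ ^ 2 :=
        sum_sq_norm_coeff_le_sq_norm volume he hsummable.hasSum s
    _ ≤ M ^ 2 := by gcongr

end Torus

/-- The Taylor coefficients of a function on the unit polydisk bounded by `M` have square sum at
most `M ^ 2`. -/
theorem sum_sq_norm_coeff_le_of_polydisk {f : (d → ℂ) → ℂ} {c : (d → ℕ) → ℂ} {M : ℝ}
    (hsum : ∀ z : d → ℂ, (∀ i, ‖z i‖ < 1) → HasSum (fun α : d → ℕ => c α * ∏ i, z i ^ α i) (f z))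
    (hM : 0 ≤ M) (hb : ∀ z : d → ℂ, (∀ i, ‖z i‖ < 1) → ‖f z‖ ≤ M) (s : Finset (d → ℕ)) :
    ∑ α ∈ s, ‖c α‖ ^ 2 ≤ M ^ 2 := by
  have hcont : Continuous fun ρ : ℝ => ∑ α ∈ s, ‖c α * ∏ i, (ρ : ℂ) ^ α i‖ ^ 2 := by fun_prop
  have hlim := (hcont.tendsto 1).mono_left (nhdsWithin_le_nhds (s := Set.Iio 1))
  simp only [Complex.ofReal_one, one_pow, Finset.prod_const_one, mul_one] at hlim
  refine le_of_tendsto hlim ?_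
  filter_upwards [Ioo_mem_nhdsLT (zero_lt_one' ℝ)] with ρ hρ
  exact sum_sq_norm_coeff_mul_pow_le hρ.1.le (fun z hz => hsum z fun i => (hz i).trans_lt hρ.2) hM
    (fun z hz => hb z fun i => (hz i).trans_lt hρ.2) s

/-- Finite partial sums of the multivariate geometric series are bounded by its value. -/
theorem sum_prod_pow_le {q : ℝ} (hq0 : 0 ≤ q) (hq1 : q < 1) (s : Finset (d → ℕ)) :
    ∑ α ∈ s, ∏ i, q ^ α i ≤ ((1 - q)⁻¹) ^ Fintype.card d := by
  classical
  set N := s.sup fun α => Finset.univ.sup α + 1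
  have hs : s ⊆ Fintype.piFinset fun _ : d => Finset.range N := fun α hα => by
    refine Fintype.mem_piFinset.mpr fun i => Finset.mem_range.mpr ?_
    exact (Nat.lt_succ_of_le (Finset.le_sup (f := α) (Finset.mem_univ i))).trans_le
      (Finset.le_sup (f := fun α : d → ℕ => Finset.univ.sup α + 1) hα)
  calc ∑ α ∈ s, ∏ i, q ^ α i
      ≤ ∑ α ∈ Fintype.piFinset fun _ : d => Finset.range N, ∏ i, q ^ α i :=
        Finset.sum_le_sum_of_subset_of_nonneg hs fun _ _ _ => by positivity
    _ = ∏ _i : d, ∑ k ∈ Finset.range N, q ^ k := (Finset.prod_univ_sum _ _).symm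
    _ = (∑ k ∈ Finset.range N, q ^ k) ^ Fintype.card d := by simp
    _ ≤ ((1 - q)⁻¹) ^ Fintype.card d := by
        rw [← tsum_geometric_of_lt_one hq0 hq1]
        gcongr
        exact (summable_geometric_of_lt_one hq0 hq1).sum_le_tsum _ fun _ _ => by positivity

/-- Finite partial sums of the multivariate geometric series without its constant term. -/
theorem sum_prod_pow_le_of_zero_notMem {q : ℝ} (hq0 : 0 ≤ q) (hq1 : q < 1)
    (hdq : Fintype.card d * q < 1) {s : Finset (d → ℕ)} (hs : 0 ∉ s) :
    ∑ α ∈ s, ∏ i, q ^ α i ≤ Fintype.card d * q / (1 - Fintype.card d * q) := by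
  classical
  have h₁ := sum_prod_pow_le hq0 hq1 (insert 0 s)
  simp only [Finset.sum_insert hs, Pi.zero_apply, pow_zero, Finset.prod_const_one] at h₁
  have h₂ : 1 - Fintype.card d * q ≤ (1 - q) ^ Fintype.card d := by
    have := one_add_mul_sub_le_pow (a := 1 - q) (by linarith) (Fintype.card d)
    linarith
  have h₃ : ((1 - q)⁻¹) ^ Fintype.card d ≤ (1 - Fintype.card d * q)⁻¹ := by
    rw [inv_pow]
    exact inv_anti₀ (by linarith) h₂
  have h₄ : Fintype.card d * q / (1 - Fintype.card d * q) = (1 - Fintype.card d * q)⁻¹ - 1 := by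
    have : 1 - Fintype.card d * q ≠ 0 := by linarith
    field_simp
    ring
  linarith

end Polydisk


/-- The key estimate in the proof of Theorem 3 of Liu–Ponnusamy: if
`f(z) = Σ_α c_α z^α` is holomorphic on the unit polydisk `𝔻ⁿ` with `f(0) = 0` and
`|f| < 1`, then for `r ∈ [0,1)` with `n r² < 1` and `|z_j| ≤ r` for all `j`,
`Σ_{α ≠ 0} |c_α| |z^α| ≤ √(n r² / (1 - n r²))`. -/
theorem stmt_17 (n : ℕ) (f : (Fin n → ℂ) → ℂ) (c : (Fin n → ℕ) → ℂ)
    (hf : DifferentiableOn ℂ f {z : Fin n → ℂ | ∀ i, ‖z i‖ < 1})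
    (hsum : ∀ z : Fin n → ℂ, (∀ i, ‖z i‖ < 1) →
      HasSum (fun α : Fin n → ℕ => c α * ∏ i, z i ^ α i) (f z))
    (hf0 : f 0 = 0)
    (hb : ∀ z : Fin n → ℂ, (∀ i, ‖z i‖ < 1) → ‖f z‖ < 1)
    (r : ℝ) (hr0 : 0 ≤ r) (hr1 : r < 1) (hnr : (n : ℝ) * r ^ 2 < 1)
    (z : Fin n → ℂ) (hz : ∀ i, ‖z i‖ ≤ r) :
    Summable (fun α : {α : Fin n → ℕ // α ≠ 0} => ‖c α.1‖ * ∏ i, ‖z i‖ ^ α.1 i) ∧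
    ∑' α : {α : Fin n → ℕ // α ≠ 0}, ‖c α.1‖ * ∏ i, ‖z i‖ ^ α.1 i ≤
      Real.sqrt ((n : ℝ) * r ^ 2 / (1 - (n : ℝ) * r ^ 2)) := by
  have hpartial : ∀ s : Finset {α : Fin n → ℕ // α ≠ 0},
      ∑ α ∈ s, ‖c α.1‖ * ∏ i, ‖z i‖ ^ α.1 i ≤
        Real.sqrt ((n : ℝ) * r ^ 2 / (1 - (n : ℝ) * r ^ 2)) := fun s => by
    set t : Finset (Fin n → ℕ) := s.map (Function.Embedding.subtype _) with ht
    have ht0 : 0 ∉ t := by simp [ht]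
    have hcoeff : ∑ α ∈ t, ‖c α‖ ^ 2 ≤ 1 := by
      simpa using sum_sq_norm_coeff_le_of_polydisk hsum zero_le_one (fun w hw => (hb w hw).le) t
    have hgeom : ∑ α ∈ t, (∏ i, r ^ α i) ^ 2 ≤ (n : ℝ) * r ^ 2 / (1 - (n : ℝ) * r ^ 2) := by
      have := sum_prod_pow_le_of_zero_notMem (q := r ^ 2) (by positivity)
        (pow_lt_one₀ hr0 hr1 two_ne_zero) (by simpa using hnr) ht0
      simpa only [Fintype.card_fin, pow_right_comm r 2, Finset.prod_pow] using this
    calc ∑ α ∈ s, ‖c α.1‖ * ∏ i, ‖z i‖ ^ α.1 i = ∑ α ∈ t, ‖c α‖ * ∏ i, ‖z i‖ ^ α i := by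
          simp [ht]
      _ ≤ ∑ α ∈ t, ‖c α‖ * ∏ i, r ^ α i := by
          gcongr with α _ i _
          exact hz i
      _ ≤ √(∑ α ∈ t, ‖c α‖ ^ 2) * √(∑ α ∈ t, (∏ i, r ^ α i) ^ 2) :=
          Real.sum_mul_le_sqrt_mul_sqrt _ _ _
      _ ≤ 1 * √((n : ℝ) * r ^ 2 / (1 - (n : ℝ) * r ^ 2)) := by
          gcongr
          exact Real.sqrt_le_one.mpr hcoeff
      _ = _ := one_mul _
  have hnonneg : ∀ α : {α : Fin n → ℕ // α ≠ 0}, 0 ≤ ‖c α.1‖ * ∏ i, ‖z i‖ ^ α.1 i :=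
    fun _ => by positivity
  have hsummable := summable_of_sum_le hnonneg hpartial
  exact ⟨hsummable, hsummable.tsum_le_of_sum_le hpartial⟩
end
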